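/- arXiv:2507.18652 — 9 statements merged into one kernel-verified Lean document; each statement's English description precedes it below -/
import Mathlib

section
/- Let N ≥ 1, let P be an N×N real row-stochastic irreducible matrix, let λ ∈ (0,1), and let c ∈ ℝ^N be a left Perron vector of P (c has all entries positive, Σᵢ cᵢ = 1, and cᵀP = cᵀ). Then for every v ∈ ℝ^N with all entries positive and Σᵢ vᵢ = 1, the sequence of vectors xₖ defined by xₖᵀ = vᵀX(λ)^k converges to c as k → ∞, where X(λ) = (1−λ)(I − λP)⁻¹. In particular the limit does not depend on v. -/
open Matrix Filter Topology

lemma aux_nonneg {N : ℕ} (P : Matrix (Fin N) (Fin N) ℝ)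
    (hP0 : ∀ i j, 0 ≤ P i j) (hP1 : ∀ i, ∑ j, P i j = 1)
    (lam : ℝ) (hl0 : 0 < lam) (hl1 : lam < 1) (x : Fin N → ℝ)
    (hx : ∀ i, lam * (P *ᵥ x) i ≤ x i) : ∀ i, 0 ≤ x i := by
  intro i0
  haveI : Nonempty (Fin N) := ⟨i0⟩
  obtain ⟨m, hm⟩ := Finite.exists_min x
  refine le_trans ?_ (hm i0)
  have h1 : x m ≤ (P *ᵥ x) m := by
    calc x m = ∑ j, P m j * x m := by rw [← Finset.sum_mul, hP1, one_mul]
      _ ≤ ∑ j, P m j * x j :=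
        Finset.sum_le_sum fun j _ => mul_le_mul_of_nonneg_left (hm j) (hP0 m j)
      _ = (P *ᵥ x) m := rfl
  have h2 := hx m
  have h3 : lam * x m ≤ lam * (P *ᵥ x) m := mul_le_mul_of_nonneg_left h1 hl0.le
  nlinarith

lemma aux_unit {N : ℕ} (P : Matrix (Fin N) (Fin N) ℝ)
    (hP0 : ∀ i j, 0 ≤ P i j) (hP1 : ∀ i, ∑ j, P i j = 1)
    (lam : ℝ) (hl0 : 0 < lam) (hl1 : lam < 1) : IsUnit (1 - lam • P).det := by
  rw [isUnit_iff_ne_zero]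
  intro h
  obtain ⟨x, hx0, hx⟩ := Matrix.exists_mulVec_eq_zero_iff.mpr h
  apply hx0
  have e : ∀ i, x i = lam * (P *ᵥ x) i := by
    intro i
    have := congrFun hx i
    simp [Matrix.sub_mulVec, Matrix.smul_mulVec] at this
    linarith
  have a := aux_nonneg P hP0 hP1 lam hl0 hl1 x (fun i => (e i).ge)
  have b := aux_nonneg P hP0 hP1 lam hl0 hl1 (-x) (fun i => by
    have := e i
    simp [Matrix.mulVec_neg]
    linarith)
  funext i
  have := a i
  have := b i
  simp at *
  linarith

lemma aux_pos {N : ℕ} (P : Matrix (Fin N) (Fin N) ℝ)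
    (hP0 : ∀ i j, 0 ≤ P i j) (hP1 : ∀ i, ∑ j, P i j = 1)
    (hPirr : ∀ i j, ∃ k, 1 ≤ k ∧ 0 < (P ^ k) i j)
    (lam : ℝ) (hl0 : 0 < lam) (hl1 : lam < 1) (X : Matrix (Fin N) (Fin N) ℝ)
    (hX : (1 - lam • P) * X = (1 - lam) • (1 : Matrix (Fin N) (Fin N) ℝ)) :
    ∀ i j, 0 < X i j := by
  have e : X = (1 - lam) • (1 : Matrix (Fin N) (Fin N) ℝ) + lam • (P * X) := by
    rw [← hX, sub_mul, one_mul, Matrix.smul_mul]; abel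
  have e' : ∀ i j, X i j = (1 - lam) * (1 : Matrix (Fin N) (Fin N) ℝ) i j + lam * (P * X) i j := by
    intro i j
    have := congrFun (congrFun e i) j
    simpa using this
  have one0 : ∀ i j, 0 ≤ (1 - lam) * (1 : Matrix (Fin N) (Fin N) ℝ) i j := by
    intro i j
    apply mul_nonneg (by linarith)
    rw [Matrix.one_apply]; split_ifs <;> norm_num
  have X0 : ∀ i j, 0 ≤ X i j := by
    intro i j
    refine aux_nonneg P hP0 hP1 lam hl0 hl1 (fun i => X i j) (fun i => ?_) i
    have h1 := e' i j
    have h2 := one0 i j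
    have h3 : (P *ᵥ fun i => X i j) i = (P * X) i j := rfl
    rw [h3]; linarith
  have PX0 : ∀ k i j, 0 ≤ (P ^ k) i j := by
    intro k
    induction k with
    | zero => intro i j; rw [pow_zero, Matrix.one_apply]; split_ifs <;> norm_num
    | succ k ih =>
      intro i j
      rw [pow_succ, Matrix.mul_apply]
      exact Finset.sum_nonneg fun l _ => mul_nonneg (ih _ _) (hP0 _ _)
  have mono : ∀ k i j, lam ^ k * (P ^ k * X) i j ≤ X i j := by
    intro k
    induction k with
    | zero => intro i j; simp
    | succ k ih =>
      intro i j
      have h1 : lam * (P * (lam ^ k • (P ^ k * X))) i j ≤ lam * (P * X) i j := by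
        apply mul_le_mul_of_nonneg_left _ hl0.le
        rw [Matrix.mul_apply, Matrix.mul_apply]
        refine Finset.sum_le_sum fun l _ => mul_le_mul_of_nonneg_left ?_ (hP0 _ _)
        simpa using ih l j
      have h2 := e' i j
      have h3 := one0 i j
      have h4 : lam ^ (k+1) * (P ^ (k+1) * X) i j
          = lam * (P * (lam ^ k • (P ^ k * X))) i j := by
        rw [pow_succ' P, Matrix.mul_assoc, Matrix.mul_smul, Matrix.smul_apply, smul_eq_mul]
        ring
      linarith
  have PXn : ∀ i j, 0 ≤ (P * X) i j := fun i j => by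
    rw [Matrix.mul_apply]
    exact Finset.sum_nonneg fun l _ => mul_nonneg (hP0 _ _) (X0 _ _)
  intro i j
  have hjj : 0 < X j j := by
    rw [e' j j, Matrix.one_apply_eq]
    have := mul_nonneg hl0.le (PXn j j)
    linarith
  obtain ⟨k, _, hk⟩ := hPirr i j
  refine lt_of_lt_of_le ?_ (mono k i j)
  apply mul_pos (pow_pos hl0 k)
  refine lt_of_lt_of_le (mul_pos hk hjj) ?_
  rw [Matrix.mul_apply]
  exact Finset.single_le_sum (f := fun l => (P ^ k) i l * X l j)
    (fun l _ => mul_nonneg (PX0 _ _ _) (X0 _ _)) (Finset.mem_univ j)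

lemma aux_contract {N : ℕ} (X : Matrix (Fin N) (Fin N) ℝ) (d : ℝ) (c w : Fin N → ℝ)
    (hX1 : ∀ i, ∑ j, X i j = 1) (hd : ∀ i j, d * c j ≤ X i j) (hc : ∑ j, c j = 1)
    (hw : ∑ i, w i = 0) :
    ∑ j, |(w ᵥ* X) j| ≤ (1 - d) * ∑ i, |w i| := by
  calc ∑ j, |(w ᵥ* X) j| = ∑ j, |∑ i, w i * (X i j - d * c j)| := by
        refine Finset.sum_congr rfl fun j _ => ?_
        simp only [mul_sub, Finset.sum_sub_distrib, ← Finset.sum_mul, hw]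
        simp [Matrix.vecMul, dotProduct]
    _ ≤ ∑ j, ∑ i, |w i| * (X i j - d * c j) := by
        refine Finset.sum_le_sum fun j _ => (Finset.abs_sum_le_sum_abs _ _).trans_eq ?_
        refine Finset.sum_congr rfl fun i _ => ?_
        rw [abs_mul, abs_of_nonneg (sub_nonneg.mpr (hd i j))]
    _ = (1 - d) * ∑ i, |w i| := by
        rw [Finset.sum_comm, Finset.mul_sum]
        refine Finset.sum_congr rfl fun i _ => ?_
        rw [← Finset.mul_sum, Finset.sum_sub_distrib, hX1, ← Finset.mul_sum, hc]
        ring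

theorem stmt4 {N : ℕ} (hN : 1 ≤ N) (P : Matrix (Fin N) (Fin N) ℝ)
    (hP0 : ∀ i j, 0 ≤ P i j) (hP1 : ∀ i, ∑ j, P i j = 1)
    (hPirr : ∀ i j, ∃ k, 1 ≤ k ∧ 0 < (P ^ k) i j)
    (lam : ℝ) (hl0 : 0 < lam) (hl1 : lam < 1)
    (c : Fin N → ℝ) (hcpos : ∀ i, 0 < c i) (hcsum : ∑ i, c i = 1)
    (hcP : c ᵥ* P = c)
    (v : Fin N → ℝ) (hv : ∀ i, 0 < v i) (hvsum : ∑ i, v i = 1) :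
    Tendsto (fun k : ℕ => v ᵥ* (((1 - lam) • (1 - lam • P)⁻¹) ^ k)) atTop (𝓝 c) := by
  have hu := aux_unit P hP0 hP1 lam hl0 hl1
  set A := 1 - lam • P with hA
  set X := (1 - lam) • A⁻¹ with hXdef
  have hAX : A * X = (1 - lam) • (1 : Matrix (Fin N) (Fin N) ℝ) := by
    rw [hXdef, Matrix.mul_smul, Matrix.mul_nonsing_inv _ hu]
  have hXA : X * A = (1 - lam) • (1 : Matrix (Fin N) (Fin N) ℝ) := by
    rw [hXdef, Matrix.smul_mul, Matrix.nonsing_inv_mul _ hu]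
  have hne : (1 - lam) ≠ 0 := by linarith
  have hpos := aux_pos P hP0 hP1 hPirr lam hl0 hl1 X hAX
  have hPone : P *ᵥ (fun _ => (1 : ℝ)) = fun _ => 1 := by
    funext i; simp [Matrix.mulVec, dotProduct, hP1]
  have hAone : A *ᵥ (fun _ => (1 : ℝ)) = (1 - lam) • fun _ => (1 : ℝ) := by
    rw [hA, Matrix.sub_mulVec, Matrix.smul_mulVec, hPone, Matrix.one_mulVec, sub_smul, one_smul]
  have hXone : X *ᵥ (fun _ => (1 : ℝ)) = fun _ => 1 := by
    have h : X *ᵥ (A *ᵥ (fun _ => (1 : ℝ))) = (1 - lam) • fun _ => (1 : ℝ) := by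
      rw [Matrix.mulVec_mulVec, hXA, Matrix.smul_mulVec, Matrix.one_mulVec]
    rw [hAone, Matrix.mulVec_smul] at h
    exact smul_right_injective _ hne h
  have hX1 : ∀ i, ∑ j, X i j = 1 := by
    intro i
    have := congrFun hXone i
    simpa [Matrix.mulVec, dotProduct] using this
  have hcA : c ᵥ* A = (1 - lam) • c := by
    rw [hA, Matrix.vecMul_sub, Matrix.vecMul_smul, hcP, Matrix.vecMul_one, sub_smul, one_smul]
  have hcX : c ᵥ* X = c := by
    have h : (c ᵥ* A) ᵥ* X = (1 - lam) • c := by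
      rw [Matrix.vecMul_vecMul, hAX, Matrix.vecMul_smul, Matrix.vecMul_one]
    rw [hcA, Matrix.smul_vecMul] at h
    exact smul_right_injective _ hne h
  have hcXk : ∀ k : ℕ, c ᵥ* X ^ k = c := by
    intro k
    induction k with
    | zero => simp
    | succ k ih => rw [pow_succ, ← Matrix.vecMul_vecMul, ih, hcX]
  haveI : Nonempty (Fin N) := ⟨⟨0, hN⟩⟩
  obtain ⟨m, hm⟩ := Finite.exists_min (fun p : Fin N × Fin N => X p.1 p.2)
  obtain ⟨d, hd⟩ : ∃ d, d = X m.1 m.2 := ⟨_, rfl⟩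
  have hd0 : 0 < d := hd ▸ hpos _ _
  have hc1 : ∀ j, c j ≤ 1 := fun j => by
    rw [← hcsum]
    exact Finset.single_le_sum (fun i _ => (hcpos i).le) (Finset.mem_univ j)
  have hdX : ∀ i j, d * c j ≤ X i j := fun i j => by
    have h1 : d ≤ X i j := hd ▸ hm (i, j)
    have := mul_le_mul_of_nonneg_left (hc1 j) hd0.le
    linarith
  have hd1 : d ≤ 1 := by
    have h := Finset.sum_le_sum fun j (_ : j ∈ Finset.univ) => hdX m.1 j
    rw [hX1, ← Finset.mul_sum, hcsum] at h
    linarith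
  set y : ℕ → Fin N → ℝ := fun k => (v - c) ᵥ* X ^ k with hy
  have ysucc : ∀ k, y (k+1) = y k ᵥ* X := fun k => by
    simp only [hy]; rw [pow_succ, Matrix.vecMul_vecMul]
  have ysum : ∀ k, ∑ i, y k i = 0 := by
    intro k
    induction k with
    | zero => simp [hy, hvsum, hcsum]
    | succ k ih =>
      rw [ysucc]
      simp only [Matrix.vecMul, dotProduct]
      rw [Finset.sum_comm]
      simp only [← Finset.mul_sum, hX1, mul_one, ih]
  have ybd : ∀ k, ∑ i, |y k i| ≤ (1 - d) ^ k * ∑ i, |y 0 i| := by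
    intro k
    induction k with
    | zero => simp
    | succ k ih =>
      rw [ysucc, pow_succ', mul_assoc]
      exact (aux_contract X d c (y k) hX1 hdX hcsum (ysum k)).trans
        (mul_le_mul_of_nonneg_left ih (by linarith))
  have hlim : Tendsto (fun k : ℕ => (1 - d) ^ k * ∑ i, |y 0 i|) atTop (𝓝 0) := by
    have := (tendsto_pow_atTop_nhds_zero_of_lt_one (r := 1 - d) (by linarith)
      (by linarith)).mul_const (∑ i, |y 0 i|)
    simpa using this
  have yt : Tendsto y atTop (𝓝 0) := by
    rw [tendsto_pi_nhds]
    intro i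
    refine squeeze_zero_norm (fun k => ?_) hlim
    refine le_trans ?_ (ybd k)
    exact Finset.single_le_sum (f := fun i => |y k i|) (fun i _ => abs_nonneg _)
      (Finset.mem_univ i)
  have hfin := yt.add_const c
  rw [zero_add] at hfin
  refine hfin.congr fun k => ?_
  simp only [hy]
  rw [Matrix.sub_vecMul, hcXk, sub_add_cancel]
end

section
/- Let n₁, n₂ ≥ 1, N = n₁ + n₂, and let P be the N×N block-diagonal matrix with diagonal blocks P₁ (of size n₁×n₁) and P₂ (of size n₂×n₂) and zero off-diagonal blocks, where P₁ and P₂ are row-stochastic and irreducible. Let λ ∈ (0,1), let c₁ ∈ ℝ^{n₁} be a left Perron vector of P₁ and c₂ ∈ ℝ^{n₂} a left Perron vector of P₂. Then for every v ∈ ℝ^N with all entries positive and Σᵢ vᵢ = 1, writing v = (v₁ | v₂) with v₁ ∈ ℝ^{n₁}, v₂ ∈ ℝ^{n₂}, the sequence xₖᵀ = vᵀX(λ)^k converges as k → ∞ to the vector (α₁c₁ᵀ | α₂c₂ᵀ), where α₁ = Σᵢ (v₁)ᵢ = ‖v₁‖₁ and α₂ = Σᵢ (v₂)ᵢ = ‖v₂‖₁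 (so α₁, α₂ > 0 and α₁ + α₂ = 1), and X(λ) = (1−λ)(I − λP)⁻¹. -/
open Matrix Filter Topology

section Helpers

attribute [local instance] Matrix.linftyOpNormedRing Matrix.linftyOpNormedAlgebra

/-- Neumann series: existence and positivity of the resolvent. -/
lemma resolvent_pos {n : ℕ} (P : Matrix (Fin n) (Fin n) ℝ)
    (h0 : ∀ i j, 0 ≤ P i j) (h1 : ∀ i, ∑ j, P i j = 1)
    (hirr : ∀ i j, ∃ k, 1 ≤ k ∧ 0 < (P ^ k) i j)
    (l : ℝ) (hl0 : 0 < l) (hl1 : l < 1) :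
    ∃ S : Matrix (Fin n) (Fin n) ℝ, S * (1 - l • P) = 1 ∧ (1 - l • P) * S = 1 ∧
      ∀ i j, 0 < S i j := by
  have hnorm : ‖l • P‖ < 1 := by
    have hP : ‖P‖ ≤ 1 := by
      rw [← coe_nnnorm, ← NNReal.coe_one, NNReal.coe_le_coe, Matrix.linfty_opNNNorm_def]
      refine Finset.sup_le fun i _ => ?_
      rw [← NNReal.coe_le_coe]
      push_cast
      rw [← h1 i]
      exact (Finset.sum_congr rfl fun j _ => by
        rw [Real.norm_eq_abs, abs_of_nonneg (h0 i j)]).le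
    rw [norm_smul, Real.norm_eq_abs, abs_of_pos hl0]
    nlinarith [norm_nonneg P]
  have hs : Summable fun k : ℕ => (l • P) ^ k := summable_geometric_of_norm_lt_one hnorm
  refine ⟨∑' k : ℕ, (l • P) ^ k, geom_series_mul_neg _ hnorm, mul_neg_geom_series _ hnorm, ?_⟩
  intro i j
  have hcont : Continuous fun M : Matrix (Fin n) (Fin n) ℝ => M i j :=
    continuous_id.matrix_elem i j
  have hsum : HasSum (fun k : ℕ => ((l • P) ^ k) i j) ((∑' k : ℕ, (l • P) ^ k) i j) :=
    hs.hasSum.map (Matrix.entryAddMonoidHom ℝ i j) hcont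
  have hPk : ∀ k : ℕ, ∀ i j, 0 ≤ (P ^ k) i j := by
    intro k
    induction k with
    | zero => intro i j; rw [pow_zero, Matrix.one_apply]; split_ifs <;> norm_num
    | succ k ih =>
      intro i j
      rw [pow_succ, Matrix.mul_apply]
      exact Finset.sum_nonneg fun m _ => mul_nonneg (ih i m) (h0 m j)
  have hnn : ∀ k : ℕ, 0 ≤ ((l • P) ^ k) i j := by
    intro k
    rw [smul_pow, Matrix.smul_apply, smul_eq_mul]
    exact mul_nonneg (pow_nonneg hl0.le k) (hPk k i j)
  obtain ⟨k, -, hk⟩ := hirr i j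
  have hkpos : 0 < ((l • P) ^ k) i j := by
    rw [smul_pow, Matrix.smul_apply, smul_eq_mul]
    exact mul_pos (pow_pos hl0 k) hk
  exact hkpos.trans_le (le_hasSum hsum k fun m _ => hnn m)

end Helpers

/-- Contraction in the 1-norm on zero-sum vectors. -/
lemma stoch_tendsto {n : ℕ} (hn : 1 ≤ n) (X : Matrix (Fin n) (Fin n) ℝ)
    (hX : ∀ i j, 0 < X i j) (hX1 : ∀ i, ∑ j, X i j = 1)
    (c : Fin n → ℝ) (hc0 : ∀ i, 0 < c i) (hcs : ∑ i, c i = 1) (hc : c ᵥ* X = c)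
    (w : Fin n → ℝ) :
    Tendsto (fun k : ℕ => w ᵥ* X ^ k) atTop (𝓝 ((∑ i, w i) • c)) := by
  haveI : Nonempty (Fin n) := ⟨⟨0, hn⟩⟩
  obtain ⟨p, hp⟩ := Finite.exists_min fun p : Fin n × Fin n => X p.1 p.2
  set d := X p.1 p.2 with hd
  have hd0 : 0 < d := hX _ _
  have hc1 : ∀ j, c j ≤ 1 := fun j => by
    rw [← hcs]; exact Finset.single_le_sum (fun i _ => (hc0 i).le) (Finset.mem_univ j)
  have hZ : ∀ i j, 0 ≤ X i j - d * c j := fun i j => by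
    have := hp (i, j)
    simp only at this
    nlinarith [hc1 j]
  have hZs : ∀ i, ∑ j, (X i j - d * c j) = 1 - d := fun i => by
    rw [Finset.sum_sub_distrib, ← Finset.mul_sum, hX1, hcs, mul_one]
  have hd1 : 0 ≤ 1 - d := by
    rw [← hZs p.1]; exact Finset.sum_nonneg fun j _ => hZ _ j
  have hstep : ∀ y : Fin n → ℝ, ∑ i, y i = 0 →
      ∑ j, |(y ᵥ* X) j| ≤ (1 - d) * ∑ i, |y i| := by
    intro y hy
    have e : ∀ j, (y ᵥ* X) j = ∑ i, y i * (X i j - d * c j) := fun j => by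
      simp only [mul_sub, Finset.sum_sub_distrib, ← Finset.sum_mul, hy, zero_mul, sub_zero]
      rfl
    calc ∑ j, |(y ᵥ* X) j| ≤ ∑ j, ∑ i, |y i| * (X i j - d * c j) := by
          refine Finset.sum_le_sum fun j _ => ?_
          rw [e]
          refine (Finset.abs_sum_le_sum_abs _ _).trans (Finset.sum_le_sum fun i _ => ?_)
          rw [abs_mul, abs_of_nonneg (hZ i j)]
      _ = (1 - d) * ∑ i, |y i| := by
          rw [Finset.sum_comm]
          simp only [← Finset.mul_sum, hZs]
          rw [← Finset.sum_mul, mul_comm]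
  have hsum : ∀ y : Fin n → ℝ, ∑ j, (y ᵥ* X) j = ∑ i, y i := by
    intro y
    simp only [Matrix.vecMul, dotProduct]
    rw [Finset.sum_comm]
    simp only [← Finset.mul_sum, hX1, mul_one]
  set y : Fin n → ℝ := w - (∑ i, w i) • c with hy
  have hy0 : ∑ i, y i = 0 := by
    simp [hy, Finset.sum_sub_distrib, ← Finset.mul_sum, hcs]
  have hyk : ∀ k : ℕ, ∑ i, (y ᵥ* X ^ k) i = 0 ∧
      ∑ i, |(y ᵥ* X ^ k) i| ≤ (1 - d) ^ k * ∑ i, |y i| := by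
    intro k
    induction k with
    | zero => simp [hy0]
    | succ k ih =>
      rw [pow_succ, ← Matrix.vecMul_vecMul]
      refine ⟨(hsum _).trans ih.1, (hstep _ ih.1).trans ?_⟩
      calc _ ≤ (1 - d) * ((1 - d) ^ k * ∑ i, |y i|) := mul_le_mul_of_nonneg_left ih.2 hd1
        _ = _ := by ring
  have hck : ∀ k : ℕ, c ᵥ* X ^ k = c := by
    intro k
    induction k with
    | zero => simp
    | succ k ih => rw [pow_succ, ← Matrix.vecMul_vecMul, ih, hc]
  have hlim : Tendsto (fun k : ℕ => (1 - d) ^ k * ∑ i, |y i|) atTop (𝓝 0) := by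
    simpa using (tendsto_pow_atTop_nhds_zero_of_lt_one hd1 (by linarith)).mul_const (∑ i, |y i|)
  rw [tendsto_pi_nhds]
  intro j
  rw [tendsto_iff_dist_tendsto_zero]
  refine squeeze_zero (fun _ => dist_nonneg) (fun k => ?_) hlim
  have e : (w ᵥ* X ^ k) j - ((∑ i, w i) • c) j = (y ᵥ* X ^ k) j := by
    rw [hy, Matrix.sub_vecMul, Matrix.smul_vecMul, hck]; rfl
  rw [Real.dist_eq, e]
  exact (Finset.single_le_sum (f := fun i => |(y ᵥ* X ^ k) i|)
    (fun i _ => abs_nonneg _) (Finset.mem_univ j)).trans (hyk k).2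

/-- One-block version. -/
lemma block_tendsto {n : ℕ} (hn : 1 ≤ n) (P : Matrix (Fin n) (Fin n) ℝ)
    (h0 : ∀ i j, 0 ≤ P i j) (h1 : ∀ i, ∑ j, P i j = 1)
    (hirr : ∀ i j, ∃ k, 1 ≤ k ∧ 0 < (P ^ k) i j)
    (l : ℝ) (hl0 : 0 < l) (hl1 : l < 1)
    (c : Fin n → ℝ) (hc0 : ∀ i, 0 < c i) (hcs : ∑ i, c i = 1) (hc : c ᵥ* P = c) :
    ∃ S : Matrix (Fin n) (Fin n) ℝ, S * (1 - l • P) = 1 ∧ ∀ w : Fin n → ℝ,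
      Tendsto (fun k : ℕ => w ᵥ* ((1 - l) • S) ^ k) atTop (𝓝 ((∑ i, w i) • c)) := by
  obtain ⟨S, hS1, hS2, hS⟩ := resolvent_pos P h0 h1 hirr l hl0 hl1
  refine ⟨S, hS1, fun w => stoch_tendsto hn _ ?_ ?_ c hc0 hcs ?_ w⟩
  · intro i j
    exact mul_pos (by linarith) (hS i j)
  · have e : (1 - l • P) *ᵥ (fun _ => (1 : ℝ)) = (1 - l) • (fun _ => (1 : ℝ)) := by
      ext i
      rw [Matrix.sub_mulVec, Matrix.smul_mulVec, Matrix.one_mulVec]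
      simp [Matrix.mulVec, dotProduct, h1]
    have e2 : (1 - l) • (S *ᵥ (fun _ => (1 : ℝ))) = fun _ => (1 : ℝ) := by
      rw [← Matrix.mulVec_smul, ← e, Matrix.mulVec_mulVec, hS1, Matrix.one_mulVec]
    intro i
    have := congrFun e2 i
    simpa [Matrix.mulVec, dotProduct, Finset.mul_sum] using this
  · have e : c ᵥ* (1 - l • P) = (1 - l) • c := by
      rw [Matrix.vecMul_sub, Matrix.vecMul_smul, hc, Matrix.vecMul_one, sub_smul, one_smul]
    rw [Matrix.vecMul_smul, ← Matrix.smul_vecMul, ← e, Matrix.vecMul_vecMul, hS2,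
      Matrix.vecMul_one]


theorem stmt10 {n₁ n₂ : ℕ} (h1 : 1 ≤ n₁) (h2 : 1 ≤ n₂)
    (P₁ : Matrix (Fin n₁) (Fin n₁) ℝ) (P₂ : Matrix (Fin n₂) (Fin n₂) ℝ)
    (hP₁0 : ∀ i j, 0 ≤ P₁ i j) (hP₁1 : ∀ i, ∑ j, P₁ i j = 1)
    (hP₁irr : ∀ i j, ∃ k, 1 ≤ k ∧ 0 < (P₁ ^ k) i j)
    (hP₂0 : ∀ i j, 0 ≤ P₂ i j) (hP₂1 : ∀ i, ∑ j, P₂ i j = 1)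
    (hP₂irr : ∀ i j, ∃ k, 1 ≤ k ∧ 0 < (P₂ ^ k) i j)
    (lam : ℝ) (hl0 : 0 < lam) (hl1 : lam < 1)
    (c₁ : Fin n₁ → ℝ) (hc₁pos : ∀ i, 0 < c₁ i) (hc₁sum : ∑ i, c₁ i = 1)
    (hc₁ : c₁ ᵥ* P₁ = c₁)
    (c₂ : Fin n₂ → ℝ) (hc₂pos : ∀ i, 0 < c₂ i) (hc₂sum : ∑ i, c₂ i = 1)
    (hc₂ : c₂ ᵥ* P₂ = c₂)
    (v : Fin n₁ ⊕ Fin n₂ → ℝ) (hv : ∀ i, 0 < v i) (hvsum : ∑ i, v i = 1) :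
    Tendsto
      (fun k : ℕ =>
        v ᵥ* (((1 - lam) • (1 - lam • Matrix.fromBlocks P₁ 0 0 P₂)⁻¹) ^ k))
      atTop
      (𝓝 (Sum.elim ((∑ i, v (Sum.inl i)) • c₁) ((∑ i, v (Sum.inr i)) • c₂))) := by
  obtain ⟨S, hS, hSt⟩ := block_tendsto h1 P₁ hP₁0 hP₁1 hP₁irr lam hl0 hl1 c₁ hc₁pos hc₁sum hc₁
  obtain ⟨T, hT, hTt⟩ := block_tendsto h2 P₂ hP₂0 hP₂1 hP₂irr lam hl0 hl1 c₂ hc₂pos hc₂sum hc₂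
  have hinv : (1 - lam • Matrix.fromBlocks P₁ 0 0 P₂)⁻¹ = Matrix.fromBlocks S 0 0 T := by
    apply Matrix.inv_eq_left_inv
    have e : (1 - lam • Matrix.fromBlocks P₁ 0 0 P₂)
        = Matrix.fromBlocks (1 - lam • P₁) 0 0 (1 - lam • P₂) := by
      rw [← Matrix.fromBlocks_one, Matrix.fromBlocks_smul, sub_eq_add_neg, Matrix.fromBlocks_neg,
        Matrix.fromBlocks_add]
      simp [sub_eq_add_neg]
    rw [e, Matrix.fromBlocks_multiply]
    simp [hS, hT]
  have hk : ∀ k : ℕ, v ᵥ* (((1 - lam) • (1 - lam • Matrix.fromBlocks P₁ 0 0 P₂)⁻¹) ^ k)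
      = Sum.elim ((v ∘ Sum.inl) ᵥ* ((1 - lam) • S) ^ k)
          ((v ∘ Sum.inr) ᵥ* ((1 - lam) • T) ^ k) := by
    intro k
    rw [hinv, Matrix.fromBlocks_smul, smul_zero, smul_zero, Matrix.fromBlocks_diagonal_pow,
      Matrix.vecMul_fromBlocks]
    simp
  simp only [hk]
  rw [tendsto_pi_nhds]
  rintro (i | i)
  · exact (tendsto_pi_nhds.1 (hSt (v ∘ Sum.inl))) i
  · exact (tendsto_pi_nhds.1 (hTt (v ∘ Sum.inr))) i
end

section
/- Let n₁, n₂ ≥ 1, N = n₁ + n₂, and let P be the N×N block-diagonal matrix with diagonal blocks P₁ and P₂ (row-stochastic and irreducible, of sizes n₁ and n₂) and zero off-diagonal blocks. Let λ ∈ (0,1), let c₁ be the left Perron vector of P₁ and c₂ the left Perron vector of P₂. Then a vector v ∈ ℝ^N with all entries positive and Σᵢ vᵢ = 1 satisfies (1−λ)vᵀ(I − λP)⁻¹ = vᵀ if and only if v = (α₁c₁ | α₂c₂) for some α₁, α₂ > 0 with α₁ + α₂ = 1. In particular, the PageRank map PR_λ has infinitely many fixed points on the open simplex, and the fixed point set is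 the open segment between (c₁ | 0) and (0 | c₂). -/
open Matrix Filter Topology

theorem perron_unique {n : ℕ} (hn : 1 ≤ n) (P : Matrix (Fin n) (Fin n) ℝ)
    (h0 : ∀ i j, 0 ≤ P i j) (hirr : ∀ i j, ∃ k, 1 ≤ k ∧ 0 < (P ^ k) i j)
    (c : Fin n → ℝ) (hcpos : ∀ i, 0 < c i) (hc : c ᵥ* P = c)
    (w : Fin n → ℝ) (hw : w ᵥ* P = w) : ∃ t : ℝ, w = t • c := by
  haveI : Nonempty (Fin n) := ⟨⟨0, hn⟩⟩
  obtain ⟨i, hi⟩ := Finite.exists_min (fun i => w i / c i)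
  refine ⟨w i / c i, ?_⟩
  set t := w i / c i with ht
  have hu0 : ∀ j, 0 ≤ (w - t • c) j := by
    intro j
    have := (le_div_iff₀ (hcpos j)).1 (hi j)
    simp only [Pi.sub_apply, Pi.smul_apply, smul_eq_mul]
    linarith
  have hui : (w - t • c) i = 0 := by
    have := (hcpos i).ne'
    simp only [Pi.sub_apply, Pi.smul_apply, smul_eq_mul, ht]
    field_simp
    simp
  have huP : (w - t • c) ᵥ* P = w - t • c := by
    rw [Matrix.sub_vecMul, Matrix.smul_vecMul, hw, hc]
  generalize hu : w - t • c = u at *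
  have hpow : ∀ k : ℕ, u ᵥ* (P ^ k) = u := by
    intro k
    induction k with
    | zero => simp
    | succ k ih => rw [pow_succ, ← Matrix.vecMul_vecMul, ih, huP]
  have hPk : ∀ k : ℕ, ∀ a b, 0 ≤ (P ^ k) a b := by
    intro k
    induction k with
    | zero => intro a b; rw [pow_zero, Matrix.one_apply]; split_ifs <;> norm_num
    | succ k ih =>
      intro a b
      rw [pow_succ, Matrix.mul_apply]
      exact Finset.sum_nonneg fun x _ => mul_nonneg (ih _ _) (h0 _ _)
  have hz : u = 0 := by
    funext j
    obtain ⟨k, -, hk⟩ := hirr j i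
    have h : ∑ x, u x * (P ^ k) x i = 0 := by
      have := congrFun (hpow k) i
      rw [hui] at this
      simpa [Matrix.vecMul, dotProduct] using this
    have h2 := (Finset.sum_eq_zero_iff_of_nonneg
      (fun x _ => mul_nonneg (hu0 x) (hPk k x i))).1 h j (Finset.mem_univ j)
    rcases mul_eq_zero.1 h2 with h3 | h3
    · exact h3
    · exact absurd h3 hk.ne'
  rw [hz] at hu
  exact sub_eq_zero.1 hu

theorem pr_iff {ι : Type*} [Fintype ι] [DecidableEq ι] (P : Matrix ι ι ℝ)
    (h0 : ∀ i j, 0 ≤ P i j) (hs : ∀ i, ∑ j, P i j = 1)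
    (lam : ℝ) (hl0 : 0 < lam) (hl1 : lam < 1) (v : ι → ℝ) :
    (1 - lam) • (v ᵥ* (1 - lam • P)⁻¹) = v ↔ v ᵥ* P = v := by
  have hdet : (1 - lam • P).det ≠ 0 := by
    apply det_ne_zero_of_sum_row_lt_diag
    intro k
    have e : ∑ j ∈ Finset.univ.erase k, ‖(1 - lam • P) k j‖
        = ∑ j ∈ Finset.univ.erase k, lam * P k j := by
      apply Finset.sum_congr rfl
      intro j hj
      have : k ≠ j := (Finset.ne_of_mem_erase hj).symm
      simp [Matrix.one_apply, this, abs_of_nonneg (h0 k j), abs_of_pos hl0]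
    have e2 := Finset.add_sum_erase Finset.univ (fun j => P k j) (Finset.mem_univ k)
    rw [hs k] at e2
    rw [e, ← Finset.mul_sum]
    have : (1 - lam • P) k k = 1 - lam * P k k := by simp
    rw [this, Real.norm_eq_abs]
    refine lt_of_lt_of_le ?_ (le_abs_self _)
    have e3 : ∑ j ∈ Finset.univ.erase k, P k j = 1 - P k k := by linarith
    rw [e3]
    linarith
  have hunit : IsUnit (1 - lam • P).det := hdet.isUnit
  have key : v ᵥ* (1 - lam • P) = v - lam • (v ᵥ* P) := by
    rw [Matrix.vecMul_sub, Matrix.vecMul_one, Matrix.vecMul_smul]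
  constructor
  · intro h
    have h2 := congrArg (fun x => x ᵥ* (1 - lam • P)) h
    simp only [Matrix.smul_vecMul, Matrix.vecMul_vecMul, Matrix.nonsing_inv_mul _ hunit,
      Matrix.vecMul_one, key] at h2
    funext i
    have h3 := congrFun h2 i
    simp only [Pi.sub_apply, Pi.smul_apply, smul_eq_mul] at h3
    have : lam * (v ᵥ* P) i = lam * v i := by linarith
    exact mul_left_cancel₀ hl0.ne' this
  · intro h
    have h2 : v ᵥ* (1 - lam • P) = (1 - lam) • v := by
      rw [key, h, sub_smul, one_smul]
    rw [← Matrix.smul_vecMul, ← h2, Matrix.vecMul_vecMul, Matrix.mul_nonsing_inv _ hunit,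
      Matrix.vecMul_one]

theorem stmt11 {n₁ n₂ : ℕ} (h1 : 1 ≤ n₁) (h2 : 1 ≤ n₂)
    (P₁ : Matrix (Fin n₁) (Fin n₁) ℝ) (P₂ : Matrix (Fin n₂) (Fin n₂) ℝ)
    (hP₁0 : ∀ i j, 0 ≤ P₁ i j) (hP₁1 : ∀ i, ∑ j, P₁ i j = 1)
    (hP₁irr : ∀ i j, ∃ k, 1 ≤ k ∧ 0 < (P₁ ^ k) i j)
    (hP₂0 : ∀ i j, 0 ≤ P₂ i j) (hP₂1 : ∀ i, ∑ j, P₂ i j = 1)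
    (hP₂irr : ∀ i j, ∃ k, 1 ≤ k ∧ 0 < (P₂ ^ k) i j)
    (lam : ℝ) (hl0 : 0 < lam) (hl1 : lam < 1)
    (c₁ : Fin n₁ → ℝ) (hc₁pos : ∀ i, 0 < c₁ i) (hc₁sum : ∑ i, c₁ i = 1)
    (hc₁ : c₁ ᵥ* P₁ = c₁)
    (c₂ : Fin n₂ → ℝ) (hc₂pos : ∀ i, 0 < c₂ i) (hc₂sum : ∑ i, c₂ i = 1)
    (hc₂ : c₂ ᵥ* P₂ = c₂) :
    (∀ v : Fin n₁ ⊕ Fin n₂ → ℝ, (∀ i, 0 < v i) → (∑ i, v i = 1) →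
      ((1 - lam) • (v ᵥ* (1 - lam • Matrix.fromBlocks P₁ 0 0 P₂)⁻¹) = v ↔
        ∃ α₁ α₂ : ℝ, 0 < α₁ ∧ 0 < α₂ ∧ α₁ + α₂ = 1 ∧
          v = Sum.elim (α₁ • c₁) (α₂ • c₂))) ∧
    {v : Fin n₁ ⊕ Fin n₂ → ℝ | (∀ i, 0 < v i) ∧ (∑ i, v i = 1) ∧
      (1 - lam) • (v ᵥ* (1 - lam • Matrix.fromBlocks P₁ 0 0 P₂)⁻¹) = v}.Infinite := by
  have hB0 : ∀ i j, 0 ≤ (Matrix.fromBlocks P₁ 0 0 P₂) i j := by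
    rintro (i | i) (j | j) <;> simp [hP₁0, hP₂0]
  have hBs : ∀ i, ∑ j, (Matrix.fromBlocks P₁ 0 0 P₂) i j = 1 := by
    rintro (i | i) <;> simp [hP₁1, hP₂1]
  have hiff := pr_iff _ hB0 hBs lam hl0 hl1
  have main : ∀ v : Fin n₁ ⊕ Fin n₂ → ℝ, (∀ i, 0 < v i) → (∑ i, v i = 1) →
      ((1 - lam) • (v ᵥ* (1 - lam • Matrix.fromBlocks P₁ 0 0 P₂)⁻¹) = v ↔
        ∃ α₁ α₂ : ℝ, 0 < α₁ ∧ 0 < α₂ ∧ α₁ + α₂ = 1 ∧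
          v = Sum.elim (α₁ • c₁) (α₂ • c₂)) := by
    intro v hv hs
    rw [hiff]
    constructor
    · intro h
      rw [Matrix.vecMul_fromBlocks] at h
      have ha : (v ∘ Sum.inl) ᵥ* P₁ = v ∘ Sum.inl := by
        funext i; simpa using congrFun h (Sum.inl i)
      have hb : (v ∘ Sum.inr) ᵥ* P₂ = v ∘ Sum.inr := by
        funext i; simpa using congrFun h (Sum.inr i)
      obtain ⟨a, ha⟩ := perron_unique h1 P₁ hP₁0 hP₁irr c₁ hc₁pos hc₁ _ ha
      obtain ⟨b, hb⟩ := perron_unique h2 P₂ hP₂0 hP₂irr c₂ hc₂pos hc₂ _ hb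
      have ha' : ∀ i, v (Sum.inl i) = a * c₁ i := fun i => congrFun ha i
      have hb' : ∀ i, v (Sum.inr i) = b * c₂ i := fun i => congrFun hb i
      refine ⟨a, b, ?_, ?_, ?_, ?_⟩
      · have := hv (Sum.inl ⟨0, h1⟩)
        rw [ha'] at this
        exact pos_of_mul_pos_left this (hc₁pos _).le
      · have := hv (Sum.inr ⟨0, h2⟩)
        rw [hb'] at this
        exact pos_of_mul_pos_left this (hc₂pos _).le
      · rw [Fintype.sum_sum_type] at hs
        simpa [ha', hb', ← Finset.mul_sum, hc₁sum, hc₂sum] using hs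
      · funext i
        rcases i with i | i
        · simp [ha']
        · simp [hb']
    · rintro ⟨a, b, -, -, -, rfl⟩
      rw [Matrix.vecMul_fromBlocks]
      simp [Matrix.smul_vecMul, hc₁, hc₂]
  refine ⟨main, ?_⟩
  have hinj : Function.Injective
      (fun a : ℝ => (Sum.elim (a • c₁) ((1 - a) • c₂) : Fin n₁ ⊕ Fin n₂ → ℝ)) := by
    intro a b hab
    have h := congrFun hab (Sum.inl ⟨0, h1⟩)
    simp only [Sum.elim_inl, Pi.smul_apply, smul_eq_mul] at h
    exact mul_right_cancel₀ (hc₁pos _).ne' h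
  refine ((Set.Ioo_infinite (zero_lt_one' ℝ)).image hinj.injOn).mono ?_
  rintro _ ⟨a, ⟨ha0, ha1⟩, rfl⟩
  have hb : 0 < 1 - a := by linarith
  have hp : ∀ i, 0 < (Sum.elim (a • c₁) ((1 - a) • c₂) : Fin n₁ ⊕ Fin n₂ → ℝ) i := by
    rintro (i | i)
    · simpa using mul_pos ha0 (hc₁pos i)
    · simpa only [Sum.elim_inr, Pi.smul_apply, smul_eq_mul] using mul_pos hb (hc₂pos i)
  have hs : ∑ i, (Sum.elim (a • c₁) ((1 - a) • c₂) : Fin n₁ ⊕ Fin n₂ → ℝ) i = 1 := by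
    rw [Fintype.sum_sum_type]
    simp [← Finset.mul_sum, hc₁sum, hc₂sum]
  exact ⟨hp, hs, (main _ hp hs).2 ⟨a, 1 - a, ha0, hb, by ring, rfl⟩⟩
end

section
/- Let n₁, n₂ ≥ 1, N = n₁ + n₂, and let P be the N×N block matrix P = [[0, P_B],[0, P₂]], where P_B is an n₁×n₂ nonnegative matrix whose rows each sum to 1, and P₂ is an n₂×n₂ row-stochastic irreducible matrix. Let λ ∈ (0,1) and let c₂ ∈ ℝ^{n₂} be a left Perron vector of P₂. Then for every v ∈ ℝ^N with all entries positive and Σᵢ vᵢ = 1, the sequence xₖᵀ = vᵀX(λ)^k converges as k → ∞ to the vector (0_{n₁}ᵀ | c₂ᵀ), where X(λ) = (1−λ)(I − λP)⁻¹. -/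
open Matrix Filter Topology

/-- One-step contraction in the l1 norm. -/
lemma contr_aux {ι : Type*} [Fintype ι] (X : Matrix ι ι ℝ) (p : ι → ℝ) (ε : ℝ)
    (hX : ∀ i j, ε * p j ≤ X i j) (hX1 : ∀ i, ∑ j, X i j = 1) (hp : ∑ j, p j = 1)
    (u : ι → ℝ) (hu : ∑ i, u i = 0) :
    ∑ j, |(u ᵥ* X) j| ≤ (1 - ε) * ∑ i, |u i| := by
  have e : ∀ j, (u ᵥ* X) j = ∑ i, u i * (X i j - ε * p j) := by
    intro j
    simp only [mul_sub, Finset.sum_sub_distrib, ← Finset.sum_mul, hu, Matrix.vecMul, dotProduct]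
    ring
  calc ∑ j, |(u ᵥ* X) j| ≤ ∑ j, ∑ i, |u i| * (X i j - ε * p j) := by
        apply Finset.sum_le_sum
        intro j _
        rw [e j]
        refine (Finset.abs_sum_le_sum_abs _ _).trans (le_of_eq ?_)
        apply Finset.sum_congr rfl
        intro i _
        rw [abs_mul, abs_of_nonneg (sub_nonneg.2 (hX i j))]
    _ = (1 - ε) * ∑ i, |u i| := by
        rw [Finset.sum_comm, Finset.mul_sum]
        apply Finset.sum_congr rfl
        intro i _
        rw [← Finset.mul_sum, Finset.sum_sub_distrib, hX1, ← Finset.mul_sum, hp]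
        ring

lemma doeblin_aux {ι : Type*} [Fintype ι] [DecidableEq ι] (X : Matrix ι ι ℝ) (p : ι → ℝ) (ε : ℝ)
    (hε : 0 < ε) (hX : ∀ i j, ε * p j ≤ X i j) (hX1 : ∀ i, ∑ j, X i j = 1)
    (hp : ∑ j, p j = 1) (hpX : p ᵥ* X = p) (v : ι → ℝ) (hv : ∑ i, v i = 1) :
    Tendsto (fun k : ℕ => v ᵥ* X ^ k) atTop (𝓝 p) := by
  have hε1 : ε ≤ 1 := by
    have : Nonempty ι := by
      by_contra h
      rw [not_nonempty_iff] at h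
      simp at hv
    obtain ⟨i⟩ := this
    have := Finset.sum_le_sum (fun j (_ : j ∈ Finset.univ) => hX i j)
    rw [hX1, ← Finset.mul_sum, hp] at this
    linarith
  have key : ∀ k : ℕ, ∑ i, (v ᵥ* X ^ k - p) i = 0 ∧
      ∑ i, |(v ᵥ* X ^ k - p) i| ≤ (1 - ε) ^ k * ∑ i, |(v - p) i| := by
    intro k
    induction k with
    | zero => simp [hv, hp]
    | succ k ih =>
      have e : v ᵥ* X ^ (k + 1) - p = (v ᵥ* X ^ k - p) ᵥ* X := by
        rw [Matrix.sub_vecMul, hpX, Matrix.vecMul_vecMul, pow_succ]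
      rw [e]
      constructor
      · simp only [Matrix.vecMul, dotProduct]
        rw [Finset.sum_comm]
        simp only [← Finset.mul_sum, hX1, mul_one]
        exact ih.1
      · refine (contr_aux X p ε hX hX1 hp _ ih.1).trans ?_
        rw [pow_succ', mul_assoc]
        exact mul_le_mul_of_nonneg_left ih.2 (by linarith)
  rw [tendsto_pi_nhds]
  intro j
  rw [tendsto_iff_norm_sub_tendsto_zero]
  have h0 : Tendsto (fun k : ℕ => (1 - ε) ^ k * ∑ i, |(v - p) i|) atTop (𝓝 0) := by
    simpa using (tendsto_pow_atTop_nhds_zero_of_lt_one (by linarith : 0 ≤ 1 - ε)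
      (by linarith)).mul_const (∑ i, |(v - p) i|)
  refine squeeze_zero (fun _ => norm_nonneg _) (fun k => ?_) h0
  refine le_trans ?_ (key k).2
  rw [Real.norm_eq_abs]
  exact Finset.single_le_sum (f := fun i => |(v ᵥ* X ^ k - p) i|)
    (fun i _ => abs_nonneg _) (Finset.mem_univ j)

lemma isUnit_aux {ι : Type*} [Fintype ι] [DecidableEq ι] (P : Matrix ι ι ℝ)
    (hP0 : ∀ i j, 0 ≤ P i j) (hP1 : ∀ i, ∑ j, P i j = 1) (lam : ℝ) (hl0 : 0 < lam)
    (hl1 : lam < 1) : IsUnit (1 - lam • P).det := by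
  rw [isUnit_iff_ne_zero]
  apply det_ne_zero_of_sum_row_lt_diag
  intro i
  have h := hP1 i
  rw [← Finset.add_sum_erase _ _ (Finset.mem_univ i)] at h
  have hs : ∑ j ∈ Finset.univ.erase i, ‖(1 - lam • P) i j‖
      = lam * ∑ j ∈ Finset.univ.erase i, P i j := by
    rw [Finset.mul_sum]
    apply Finset.sum_congr rfl
    intro j hj
    have : i ≠ j := (Finset.ne_of_mem_erase hj).symm
    simp [this, abs_of_nonneg (hP0 i j), abs_of_pos hl0]
  rw [hs]
  have : ‖(1 - lam • P) i i‖ ≥ 1 - lam * P i i := by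
    simp only [Matrix.sub_apply, Matrix.one_apply_eq, Matrix.smul_apply, smul_eq_mul]
    exact le_abs_self _
  nlinarith

/-- Minimum principle: nonnegativity of solutions of `f ≥ lam P f`. -/
lemma nonneg_aux {ι : Type*} [Fintype ι] (P : Matrix ι ι ℝ)
    (hP0 : ∀ i j, 0 ≤ P i j) (hP1 : ∀ i, ∑ j, P i j = 1) (lam : ℝ) (hl0 : 0 < lam)
    (hl1 : lam < 1) (f : ι → ℝ) (hf : ∀ i, lam * ∑ l, P i l * f l ≤ f i) (i : ι) : 0 ≤ f i := by
  have : Nonempty ι := ⟨i⟩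
  obtain ⟨m, hm⟩ := Finite.exists_min f
  have h : f m ≤ ∑ l, P m l * f l := by
    calc f m = ∑ l, P m l * f m := by rw [← Finset.sum_mul, hP1, one_mul]
      _ ≤ _ := Finset.sum_le_sum fun l _ => mul_le_mul_of_nonneg_left (hm l) (hP0 m l)
  have := hf m
  have : 0 ≤ f m := by nlinarith
  exact this.trans (hm i)

lemma pow_aux {ι : Type*} [Fintype ι] [DecidableEq ι] (P : Matrix ι ι ℝ)
    (hP0 : ∀ i j, 0 ≤ P i j) (lam : ℝ) (hl0 : 0 < lam)
    (f : ι → ℝ) (hf : ∀ i, lam * ∑ l, P i l * f l ≤ f i) (k : ℕ) :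
    ∀ i, lam ^ k * ∑ l, (P ^ k) i l * f l ≤ f i := by
  induction k with
  | zero => intro i; simp [Matrix.one_apply]
  | succ k ih =>
    intro i
    refine le_trans (le_of_eq ?_) ((mul_le_mul_of_nonneg_left
      (Finset.sum_le_sum fun l _ => mul_le_mul_of_nonneg_left (ih l) (hP0 i l)) hl0.le).trans
        (hf i))
    have h1 : ∀ i, ∑ l, (P ^ (k+1)) i l * f l = ((P ^ (k+1)) *ᵥ f) i := fun i => rfl
    have h2 : ∀ i, ∑ l, (P ^ k) i l * f l = ((P ^ k) *ᵥ f) i := fun i => rfl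
    have h3 : ∑ l, P i l * ((P ^ k) *ᵥ f) l = (P *ᵥ ((P ^ k) *ᵥ f)) i := rfl
    have h4 : ∑ l, P i l * (lam ^ k * ((P ^ k) *ᵥ f) l)
        = lam ^ k * ∑ l, P i l * ((P ^ k) *ᵥ f) l := by
      rw [Finset.mul_sum]
      exact Finset.sum_congr rfl fun _ _ => by ring
    simp only [h1, h2]
    rw [h4, h3, Matrix.mulVec_mulVec, ← pow_succ', pow_succ lam]
    ring

theorem stmt12 {n₁ n₂ : ℕ} (h1 : 1 ≤ n₁) (h2 : 1 ≤ n₂)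
    (PB : Matrix (Fin n₁) (Fin n₂) ℝ) (P₂ : Matrix (Fin n₂) (Fin n₂) ℝ)
    (hPB0 : ∀ i j, 0 ≤ PB i j) (hPB1 : ∀ i, ∑ j, PB i j = 1)
    (hP₂0 : ∀ i j, 0 ≤ P₂ i j) (hP₂1 : ∀ i, ∑ j, P₂ i j = 1)
    (hP₂irr : ∀ i j, ∃ k, 1 ≤ k ∧ 0 < (P₂ ^ k) i j)
    (lam : ℝ) (hl0 : 0 < lam) (hl1 : lam < 1)
    (c₂ : Fin n₂ → ℝ) (hc₂pos : ∀ i, 0 < c₂ i) (hc₂sum : ∑ i, c₂ i = 1)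
    (hc₂ : c₂ ᵥ* P₂ = c₂)
    (v : Fin n₁ ⊕ Fin n₂ → ℝ) (hv : ∀ i, 0 < v i) (hvsum : ∑ i, v i = 1) :
    Tendsto
      (fun k : ℕ =>
        v ᵥ* (((1 - lam) • (1 - lam • Matrix.fromBlocks 0 PB 0 P₂)⁻¹) ^ k))
      atTop (𝓝 (Sum.elim (0 : Fin n₁ → ℝ) c₂)) := by
  set P : Matrix (Fin n₁ ⊕ Fin n₂) (Fin n₁ ⊕ Fin n₂) ℝ := Matrix.fromBlocks 0 PB 0 P₂ with hP
  have hP0 : ∀ i j, 0 ≤ P i j := by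
    rintro (i | i) (j | j) <;> simp [hP, hPB0, hP₂0]
  have hP1 : ∀ i, ∑ j, P i j = 1 := by
    rintro (i | i) <;> simp [hP, hPB1, hP₂1]
  have hu := isUnit_aux P hP0 hP1 lam hl0 hl1
  set X := (1 - lam) • (1 - lam • P)⁻¹ with hX
  have hAX : (1 - lam • P) * X = (1 - lam) • 1 := by
    rw [hX, Matrix.mul_smul, Matrix.mul_nonsing_inv _ hu]
  have hXA : X * (1 - lam • P) = (1 - lam) • 1 := by
    rw [hX, Matrix.smul_mul, Matrix.nonsing_inv_mul _ hu]
  have hrec : ∀ i j, X i j = (1 - lam) * (1 : Matrix _ _ ℝ) i j + lam * ∑ l, P i l * X l j := by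
    intro i j
    have := congrFun (congrFun hAX i) j
    rw [Matrix.sub_mul, Matrix.one_mul, Matrix.smul_mul] at this
    simp only [Matrix.sub_apply, Matrix.smul_apply, smul_eq_mul, Matrix.mul_apply] at this
    linarith
  have hone : ∀ i j, 0 ≤ (1 : Matrix (Fin n₁ ⊕ Fin n₂) (Fin n₁ ⊕ Fin n₂) ℝ) i j := by
    intro i j
    rw [Matrix.one_apply]
    split_ifs <;> norm_num
  have hXge : ∀ i j, lam * ∑ l, P i l * X l j ≤ X i j := by
    intro i j
    have := mul_nonneg (by linarith : 0 ≤ 1 - lam) (hone i j)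
    linarith [hrec i j]
  have hX0 : ∀ i j, 0 ≤ X i j := fun i j =>
    nonneg_aux P hP0 hP1 lam hl0 hl1 (fun l => X l j) (fun i => hXge i j) i
  have hXpos2 : ∀ i j, 0 < X (Sum.inr i) (Sum.inr j) := by
    intro i j
    obtain ⟨k, -, hk⟩ := hP₂irr i j
    have h := pow_aux P₂ hP₂0 lam hl0 (fun l => X (Sum.inr l) (Sum.inr j))
      (fun i => by simpa [hP] using hXge (Sum.inr i) (Sum.inr j)) k i
    have hPk : ∀ k : ℕ, ∀ i j, 0 ≤ (P₂ ^ k) i j := by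
      intro k
      induction k with
      | zero => intro i j; rw [pow_zero, Matrix.one_apply]; split_ifs <;> norm_num
      | succ k ih =>
        intro i j
        rw [pow_succ, Matrix.mul_apply]
        exact Finset.sum_nonneg fun l _ => mul_nonneg (ih i l) (hP₂0 l j)
    have hjj : 0 < X (Sum.inr j) (Sum.inr j) := by
      rw [hrec, Matrix.one_apply_eq]
      have : 0 ≤ ∑ l, P (Sum.inr j) l * X l (Sum.inr j) :=
        Finset.sum_nonneg fun l _ => mul_nonneg (hP0 _ _) (hX0 _ _)
      have := mul_nonneg hl0.le this
      linarith
    have hs : 0 < ∑ l, (P₂ ^ k) i l * X (Sum.inr l) (Sum.inr j) :=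
      Finset.sum_pos' (fun l _ => mul_nonneg (hPk k _ _) (hX0 _ _))
        ⟨j, Finset.mem_univ _, mul_pos hk hjj⟩
    exact lt_of_lt_of_le (mul_pos (pow_pos hl0 k) hs) h
  have hXpos : ∀ i j, 0 < X i (Sum.inr j) := by
    rintro (i | i) j
    · refine lt_of_lt_of_le (mul_pos hl0 ?_) (hXge (Sum.inl i) (Sum.inr j))
      obtain ⟨l, -, hl⟩ := Finset.exists_ne_zero_of_sum_ne_zero
        (by rw [hPB1 i]; norm_num : ∑ j, PB i j ≠ 0)
      refine Finset.sum_pos' (fun l _ => mul_nonneg (hP0 _ _) (hX0 _ _))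
        ⟨Sum.inr l, Finset.mem_univ _, mul_pos ?_ (hXpos2 l j)⟩
      simpa [hP] using lt_of_le_of_ne (hPB0 i l) (Ne.symm hl)
    · exact hXpos2 i j
  have hX1 : ∀ i, ∑ j, X i j = 1 := by
    have hA1 : (1 - lam • P) *ᵥ (fun _ => (1 : ℝ)) = (1 - lam) • (fun _ => (1 : ℝ)) := by
      ext i
      rw [Matrix.sub_mulVec, Matrix.smul_mulVec]
      simp [Matrix.mulVec, dotProduct, hP1]
    have h := congrArg (fun M => M *ᵥ (fun _ => (1 : ℝ))) hXA
    simp only [← Matrix.mulVec_mulVec, hA1, Matrix.mulVec_smul, Matrix.smul_mulVec,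
      Matrix.one_mulVec] at h
    intro i
    have h' := congrFun h i
    simp only [Pi.smul_apply, smul_eq_mul, Matrix.mulVec, dotProduct, mul_one] at h'
    have : (1 - lam) ≠ 0 := by linarith
    field_simp at h'
    exact h'
  have hp : ∑ j, Sum.elim (0 : Fin n₁ → ℝ) c₂ j = 1 := by simp [hc₂sum]
  have hpP : Sum.elim (0 : Fin n₁ → ℝ) c₂ ᵥ* P = Sum.elim (0 : Fin n₁ → ℝ) c₂ := by
    rw [hP, Matrix.vecMul_fromBlocks]
    simp [hc₂]
  have hpX : Sum.elim (0 : Fin n₁ → ℝ) c₂ ᵥ* X = Sum.elim (0 : Fin n₁ → ℝ) c₂ := by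
    have h := congrArg (fun M => Sum.elim (0 : Fin n₁ → ℝ) c₂ ᵥ* M) hAX
    have hA : Sum.elim (0 : Fin n₁ → ℝ) c₂ ᵥ* (1 - lam • P)
        = (1 - lam) • Sum.elim (0 : Fin n₁ → ℝ) c₂ := by
      rw [Matrix.vecMul_sub, Matrix.vecMul_smul, hpP, Matrix.vecMul_one, sub_smul, one_smul]
    simp only [← Matrix.vecMul_vecMul, hA, Matrix.smul_vecMul, Matrix.vecMul_smul,
      Matrix.vecMul_one] at h
    exact smul_right_injective _ (by linarith : (1 - lam) ≠ 0) h
  have hne : Nonempty ((Fin n₁ ⊕ Fin n₂) × Fin n₂) := ⟨(Sum.inr ⟨0, h2⟩, ⟨0, h2⟩)⟩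
  obtain ⟨q, hq⟩ := Finite.exists_min
    (fun q : (Fin n₁ ⊕ Fin n₂) × Fin n₂ => X q.1 (Sum.inr q.2))
  refine doeblin_aux X _ (X q.1 (Sum.inr q.2)) (hXpos _ _) ?_ hX1 hp hpX v hvsum
  rintro i (j | j)
  · simpa using hX0 _ _
  · have hc : c₂ j ≤ 1 := by
      rw [← hc₂sum]
      exact Finset.single_le_sum (fun i _ => (hc₂pos i).le) (Finset.mem_univ j)
    have := hq (i, j)
    have h3 := hXpos q.1 q.2
    simp only [Sum.elim_inr] at *
    nlinarith
end

section
/- Let n₁, n₂ ≥ 1, N = n₁ + n₂, and let P be an N×N row-stochastic matrix of block form P = [[Q₁, Q_B],[0, P₂]], where Q₁ is an n₁×n₁ nonnegative irreducible matrix, Q_B is an n₁×n₂ nonnegative matrix with Q_B ≠ 0, and P₂ is an n₂×n₂ row-stochastic irreducible matrix (so each row of the top block row is jointly stochastic: the row sums of Q₁ together with Q_B equal 1). Let λ ∈ (0,1) and let c₂ ∈ ℝ^{n₂} be a left Perron vector of P₂. Then for every v ∈ ℝ^N with all entries positive and Σᵢ vᵢ = 1, the sequence xₖᵀ = vᵀX(λ)^k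 converges as k → ∞ to the vector (0_{n₁}ᵀ | c₂ᵀ), where X(λ) = (1−λ)(I − λP)⁻¹. -/
open Matrix Filter Topology

section aux
variable {ι : Type*} [Fintype ι] [DecidableEq ι]

lemma aux_min (P : Matrix ι ι ℝ) (h0 : ∀ i j, 0 ≤ P i j) (h1 : ∀ i, ∑ j, P i j = 1)
    (l : ℝ) (hl0 : 0 < l) (hl1 : l < 1) (y : ι → ℝ)
    (hy : ∀ i, 0 ≤ ((1 - l • P) *ᵥ y) i) : ∀ i, 0 ≤ y i := by
  intro i
  haveI : Nonempty ι := ⟨i⟩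
  obtain ⟨m, hm⟩ := Finite.exists_min y
  have h := hy m
  rw [Matrix.sub_mulVec, Matrix.one_mulVec, Matrix.smul_mulVec] at h
  simp only [Pi.sub_apply, Pi.smul_apply, smul_eq_mul] at h
  have h2 : y m ≤ (P *ᵥ y) m := by
    calc y m = ∑ j, P m j * y m := by rw [← Finset.sum_mul, h1, one_mul]
      _ ≤ ∑ j, P m j * y j :=
        Finset.sum_le_sum fun j _ => mul_le_mul_of_nonneg_left (hm j) (h0 m j)
      _ = _ := rfl
  refine le_trans ?_ (hm i)
  by_contra hneg
  push Not at hneg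
  have h3 : y m = l * (P *ᵥ y) m + (y m - l * (P *ᵥ y) m) := by ring
  have h4 := mul_le_mul_of_nonneg_left h2 hl0.le
  nlinarith

lemma aux_unit_s14 (P : Matrix ι ι ℝ) (h0 : ∀ i j, 0 ≤ P i j) (h1 : ∀ i, ∑ j, P i j = 1)
    (l : ℝ) (hl0 : 0 < l) (hl1 : l < 1) : IsUnit (1 - l • P) := by
  rw [← Matrix.mulVec_injective_iff_isUnit]
  intro a b hab
  have hab' : (1 - l • P) *ᵥ a = (1 - l • P) *ᵥ b := hab
  have e1 : ∀ i, 0 ≤ (a - b) i := aux_min P h0 h1 l hl0 hl1 _ (by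
    intro i; rw [Matrix.mulVec_sub, hab']; simp)
  have e2 : ∀ i, 0 ≤ (b - a) i := aux_min P h0 h1 l hl0 hl1 _ (by
    intro i; rw [Matrix.mulVec_sub, hab']; simp)
  funext i
  have := e1 i
  have := e2 i
  simp only [Pi.sub_apply] at *
  linarith

lemma aux_pos_s14 (P R : Matrix ι ι ℝ) (h0 : ∀ i j, 0 ≤ P i j) (r0 : ∀ i j, 0 ≤ R i j)
    (l : ℝ) (hl0 : 0 < l) (hR : R = 1 + l • (P * R)) (m j : ι) (hm : 0 < R m j) (k : ℕ) :
    ∀ i, 0 < (P ^ k) i m → 0 < R i j := by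
  induction k with
  | zero =>
    intro i hi
    by_cases h : i = m
    · rwa [h]
    · simp [Matrix.one_apply, h] at hi
  | succ k ih =>
    intro i hi
    rw [pow_succ', Matrix.mul_apply] at hi
    have : ∃ t, 0 < P i t * (P ^ k) t m := by
      by_contra hc
      push Not at hc
      exact absurd hi (not_lt.mpr (Finset.sum_nonpos fun t _ => hc t))
    obtain ⟨t, ht⟩ := this
    have hPt : 0 < P i t := by
      rcases (h0 i t).lt_or_eq with h | h
      · exact h
      · rw [← h] at ht; simp at ht
    have hk : 0 < (P ^ k) t m := by
      exact (mul_pos_iff_of_pos_left hPt).mp ht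
    have h3 := ih t hk
    have h4 : P i t * R t j ≤ (P * R) i j := by
      rw [Matrix.mul_apply]
      exact Finset.single_le_sum (f := fun t => P i t * R t j)
        (fun s _ => mul_nonneg (h0 i s) (r0 s j)) (Finset.mem_univ t)
    have h5 : 0 < (P * R) i j := lt_of_lt_of_le (mul_pos hPt h3) h4
    rw [hR]
    simp only [Matrix.add_apply, Matrix.smul_apply, smul_eq_mul]
    have : (0:ℝ) ≤ (1 : Matrix ι ι ℝ) i j := by
      rw [Matrix.one_apply]; split_ifs <;> norm_num
    have := mul_pos hl0 h5
    linarith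

lemma aux_conv (X : Matrix ι ι ℝ) (h0 : ∀ i j, 0 ≤ X i j) (h1 : ∀ i, ∑ j, X i j = 1)
    (j : ι) (hj : ∀ i, 0 < X i j) (c v : ι → ℝ) (hc : c ᵥ* X = c)
    (hs : ∑ i, v i = ∑ i, c i) :
    Tendsto (fun k : ℕ => v ᵥ* (X ^ k)) atTop (𝓝 c) := by
  haveI : Nonempty ι := ⟨j⟩
  obtain ⟨m, hm⟩ := Finite.exists_min (fun i => X i j)
  set e := X m j with he
  have he0 : 0 < e := hj m
  have he1 : e ≤ 1 := by
    rw [← h1 m]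
    exact Finset.single_le_sum (f := fun t => X m t) (fun t _ => h0 m t) (Finset.mem_univ j)
  have step : ∀ w : ι → ℝ, ∑ i, w i = 0 →
      ∑ i, (w ᵥ* X) i = 0 ∧ ∑ i, |(w ᵥ* X) i| ≤ (1 - e) * ∑ i, |w i| := by
    intro w hw
    constructor
    · have : ∑ i, (w ᵥ* X) i = ∑ i, ∑ t, w t * X t i := rfl
      rw [this, Finset.sum_comm]
      simp_rw [← Finset.mul_sum, h1, mul_one, hw]
    · have hY : ∀ t i, 0 ≤ X t i - (if i = j then e else 0) := by
        intro t i
        split_ifs with h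
        · rw [h]; exact sub_nonneg.mpr (hm t)
        · simpa using h0 t i
      have hYs : ∀ t, ∑ i, (X t i - (if i = j then e else 0)) = 1 - e := by
        intro t
        rw [Finset.sum_sub_distrib, h1]; simp
      calc ∑ i, |(w ᵥ* X) i| = ∑ i, |∑ t, w t * (X t i - (if i = j then e else 0))| := by
            refine Finset.sum_congr rfl fun i _ => ?_
            congr 1
            simp_rw [mul_sub]
            rw [Finset.sum_sub_distrib, ← Finset.sum_mul, hw, zero_mul, sub_zero]
            rfl
        _ ≤ ∑ i, ∑ t, |w t| * (X t i - (if i = j then e else 0)) := by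
            refine Finset.sum_le_sum fun i _ => ?_
            refine (Finset.abs_sum_le_sum_abs _ _).trans (le_of_eq ?_)
            refine Finset.sum_congr rfl fun t _ => ?_
            rw [abs_mul, abs_of_nonneg (hY t i)]
        _ = (1 - e) * ∑ i, |w i| := by
            rw [Finset.sum_comm]
            simp_rw [← Finset.mul_sum, hYs]
            rw [← Finset.sum_mul, mul_comm]
  have hcX : ∀ k : ℕ, c ᵥ* (X ^ k) = c := by
    intro k
    induction k with
    | zero => simp
    | succ k ih => rw [pow_succ, ← Matrix.vecMul_vecMul, ih, hc]
  have main : ∀ k : ℕ, ∑ i, ((v - c) ᵥ* (X ^ k)) i = 0 ∧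
      ∑ i, |((v - c) ᵥ* (X ^ k)) i| ≤ (1 - e) ^ k * ∑ i, |(v - c) i| := by
    intro k
    induction k with
    | zero => simp [hs]
    | succ k ih =>
      obtain ⟨a, b⟩ := step _ ih.1
      rw [pow_succ, ← Matrix.vecMul_vecMul]
      refine ⟨a, b.trans ?_⟩
      rw [pow_succ', mul_assoc]
      exact mul_le_mul_of_nonneg_left ih.2 (by linarith)
  rw [tendsto_pi_nhds]
  intro i
  rw [tendsto_iff_norm_sub_tendsto_zero]
  refine squeeze_zero (g := fun k : ℕ => (1 - e) ^ k * ∑ i, |(v - c) i|)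
    (fun _ => norm_nonneg _) (fun k => ?_) ?_
  · refine le_trans ?_ (main k).2
    rw [Matrix.sub_vecMul, hcX, Real.norm_eq_abs]
    exact Finset.single_le_sum (f := fun i => |(v ᵥ* X ^ k - c) i|)
      (fun s _ => abs_nonneg _) (Finset.mem_univ i)
  · have := (tendsto_pow_atTop_nhds_zero_of_lt_one (r := 1 - e) (by linarith)
      (by linarith)).mul_const (∑ i, |(v - c) i|)
    simpa using this

lemma aux_main (P : Matrix ι ι ℝ) (h0 : ∀ i j, 0 ≤ P i j) (h1 : ∀ i, ∑ j, P i j = 1)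
    (l : ℝ) (hl0 : 0 < l) (hl1 : l < 1) (c v : ι → ℝ) (hc : c ᵥ* P = c)
    (hs : ∑ i, v i = ∑ i, c i) (j : ι)
    (hreach : ∀ R : ι → Prop, R j →
      (∀ i m, R m → (∃ k, 0 < (P ^ k) i m) → R i) → ∀ i, R i) :
    Tendsto (fun k : ℕ => v ᵥ* (((1 - l) • (1 - l • P)⁻¹) ^ k)) atTop (𝓝 c) := by
  have hu := aux_unit_s14 P h0 h1 l hl0 hl1
  have hd : IsUnit (1 - l • P).det := (Matrix.isUnit_iff_isUnit_det _).mp hu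
  set R := (1 - l • P)⁻¹ with hRdef
  have hAR : (1 - l • P) * R = 1 := Matrix.mul_nonsing_inv _ hd
  have hRA : R * (1 - l • P) = 1 := Matrix.nonsing_inv_mul _ hd
  have hl : 0 < 1 - l := by linarith
  have r0 : ∀ i j, 0 ≤ R i j := by
    intro i j
    refine aux_min P h0 h1 l hl0 hl1 (fun i => R i j) ?_ i
    intro i
    have : ((1 - l • P) *ᵥ fun i => R i j) i = ((1 - l • P) * R) i j := rfl
    rw [this, hAR, Matrix.one_apply]
    split_ifs <;> norm_num
  have hReq : R = 1 + l • (P * R) := by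
    rw [Matrix.sub_mul, Matrix.one_mul, Matrix.smul_mul] at hAR
    rw [← hAR]; abel
  have hP1 : P *ᵥ (fun _ => 1) = fun _ => (1:ℝ) := by
    funext i
    simp [Matrix.mulVec, dotProduct, h1]
  have hR1 : (1 - l) • (R *ᵥ (fun _ => 1)) = fun _ => (1:ℝ) := by
    have e : (1 - l • P) *ᵥ (fun _ => (1:ℝ)) = (1 - l) • fun _ => (1:ℝ) := by
      rw [Matrix.sub_mulVec, Matrix.smul_mulVec, hP1, Matrix.one_mulVec, sub_smul, one_smul]
    rw [← Matrix.mulVec_smul, ← e, Matrix.mulVec_mulVec, hRA, Matrix.one_mulVec]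
  have hcR : c ᵥ* ((1 - l) • R) = c := by
    have e : c ᵥ* (1 - l • P) = (1 - l) • c := by
      rw [Matrix.vecMul_sub, Matrix.vecMul_smul, hc, Matrix.vecMul_one, sub_smul, one_smul]
    rw [Matrix.vecMul_smul, ← Matrix.smul_vecMul, ← e, Matrix.vecMul_vecMul, hAR,
      Matrix.vecMul_one]
  refine aux_conv _ ?_ ?_ j ?_ c v hcR hs
  · intro i j
    exact mul_nonneg hl.le (r0 i j)
  · intro i
    have := congrFun hR1 i
    simpa [Matrix.mulVec, dotProduct, Finset.mul_sum] using this
  · have hjj : 0 < R j j := by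
      rw [hReq]
      have : 0 ≤ (P * R) j j := by
        rw [Matrix.mul_apply]
        exact Finset.sum_nonneg fun t _ => mul_nonneg (h0 _ _) (r0 _ _)
      simp only [Matrix.add_apply, Matrix.smul_apply, smul_eq_mul, Matrix.one_apply_eq]
      have := mul_nonneg hl0.le this
      linarith
    have := hreach (fun i => 0 < R i j) hjj (fun i m hm ⟨k, hk⟩ =>
      aux_pos_s14 P R h0 r0 l hl0 hReq m j hm k i hk)
    intro i
    exact mul_pos hl (this i)

end aux

theorem stmt14 {n₁ n₂ : ℕ} (h1 : 1 ≤ n₁) (h2 : 1 ≤ n₂)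
    (Q₁ : Matrix (Fin n₁) (Fin n₁) ℝ) (QB : Matrix (Fin n₁) (Fin n₂) ℝ)
    (P₂ : Matrix (Fin n₂) (Fin n₂) ℝ)
    (hQ₁0 : ∀ i j, 0 ≤ Q₁ i j)
    (hQ₁irr : ∀ i j, ∃ k, 1 ≤ k ∧ 0 < (Q₁ ^ k) i j)
    (hQB0 : ∀ i j, 0 ≤ QB i j) (hQBne : QB ≠ 0)
    (hjoint : ∀ i, (∑ j, Q₁ i j) + (∑ j, QB i j) = 1)
    (hP₂0 : ∀ i j, 0 ≤ P₂ i j) (hP₂1 : ∀ i, ∑ j, P₂ i j = 1)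
    (hP₂irr : ∀ i j, ∃ k, 1 ≤ k ∧ 0 < (P₂ ^ k) i j)
    (lam : ℝ) (hl0 : 0 < lam) (hl1 : lam < 1)
    (c₂ : Fin n₂ → ℝ) (hc₂pos : ∀ i, 0 < c₂ i) (hc₂sum : ∑ i, c₂ i = 1)
    (hc₂ : c₂ ᵥ* P₂ = c₂)
    (v : Fin n₁ ⊕ Fin n₂ → ℝ) (hv : ∀ i, 0 < v i) (hvsum : ∑ i, v i = 1) :
    Tendsto
      (fun k : ℕ =>
        v ᵥ* (((1 - lam) • (1 - lam • Matrix.fromBlocks Q₁ QB 0 P₂)⁻¹) ^ k))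
      atTop (𝓝 (Sum.elim (0 : Fin n₁ → ℝ) c₂)) := by
  have hpow : ∀ k : ℕ, ∃ C, (Matrix.fromBlocks Q₁ QB 0 P₂) ^ k =
      Matrix.fromBlocks (Q₁ ^ k) C 0 (P₂ ^ k) := by
    intro k
    induction k with
    | zero => exact ⟨0, by simp⟩
    | succ k ih =>
      obtain ⟨C, hC⟩ := ih
      exact ⟨Q₁ ^ k * QB + C * P₂, by
        rw [pow_succ, hC, Matrix.fromBlocks_multiply]
        simp [pow_succ]⟩
  refine aux_main _ ?_ ?_ lam hl0 hl1 _ v ?_ ?_ (Sum.inr ⟨0, h2⟩) ?_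
  · rintro (i | i) (j | j) <;> simp [hQ₁0, hQB0, hP₂0]
  · rintro (i | i) <;> simp [Fintype.sum_sum_type, hjoint, hP₂1]
  · rw [Matrix.vecMul_fromBlocks]
    simp [hc₂]
  · simp [hvsum, Fintype.sum_sum_type, hc₂sum]
  · intro R hj hR
    have hinr : ∀ i, R (Sum.inr i) := by
      intro i
      obtain ⟨k, -, hk⟩ := hP₂irr i ⟨0, h2⟩
      obtain ⟨C, hC⟩ := hpow k
      exact hR _ _ hj ⟨k, by rw [hC]; simpa using hk⟩
    have hab : ∃ a b, 0 < QB a b := by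
      by_contra hc
      push Not at hc
      exact hQBne (by ext a b; exact le_antisymm (hc a b) (hQB0 a b))
    obtain ⟨a, b, hab⟩ := hab
    have ha : R (Sum.inl a) := hR _ _ (hinr b) ⟨1, by simpa using hab⟩
    rintro (i | i)
    · obtain ⟨k, -, hk⟩ := hQ₁irr i a
      obtain ⟨C, hC⟩ := hpow k
      exact hR _ _ ha ⟨k, by rw [hC]; simpa using hk⟩
    · exact hinr i
end

section
/- Let n₁, n₂ ≥ 1, N = n₁ + n₂, and let P be an N×N row-stochastic matrix of block form P = [[Q₁, Q_B],[0, P₂]], where Q₁ is an n₁×n₁ nonnegative irreducible matrix, Q_B is an n₁×n₂ nonnegative matrix with Q_B ≠ 0, and P₂ is an n₂×n₂ row-stochastic irreducible matrix. Let λ ∈ (0,1) and let c₂ be the left Perron vector of P₂. Then: (a) no vector v ∈ ℝ^N with all entries strictly positive and Σᵢ vᵢ = 1 satisfies (1−λ)vᵀ(I − λP)⁻¹ = vᵀ; (b) there is exactly one vector v ∈ ℝ^N with all entries nonnegative and Σᵢ vᵢ = 1 satisfying (1−λ)vᵀ(I − λP)⁻¹ = vᵀ, namely v = (0_{n₁}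 | c₂). -/
open Matrix Filter Topology

theorem aux_zero {n : ℕ} (A : Matrix (Fin n) (Fin n) ℝ) (hA : ∀ i j, 0 ≤ A i j)
    (hirr : ∀ i j, ∃ k, 1 ≤ k ∧ 0 < (A ^ k) i j) (a : Fin n → ℝ) (ha : ∀ i, 0 ≤ a i)
    (hfix : a ᵥ* A = a) (i0 : Fin n) (h0 : a i0 = 0) : a = 0 := by
  have hpow : ∀ k : ℕ, a ᵥ* (A ^ k) = a := by
    intro k
    induction k with
    | zero => simp
    | succ k ih => rw [pow_succ, ← Matrix.vecMul_vecMul, ih, hfix]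
  have hnn : ∀ k : ℕ, ∀ i j, 0 ≤ (A ^ k) i j := by
    intro k
    induction k with
    | zero => intro i j; simp only [pow_zero, Matrix.one_apply]; split_ifs <;> norm_num
    | succ k ih =>
      intro i j
      rw [pow_succ, Matrix.mul_apply]
      exact Finset.sum_nonneg fun l _ => mul_nonneg (ih i l) (hA l j)
  funext i
  obtain ⟨k, -, hk⟩ := hirr i i0
  have h := congrFun (hpow k) i0
  rw [h0] at h
  simp only [Matrix.vecMul, dotProduct] at h
  rw [Finset.sum_eq_zero_iff_of_nonneg fun l _ => mul_nonneg (ha l) (hnn k l i0)] at h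
  have := h i (Finset.mem_univ i)
  rcases mul_eq_zero.mp this with h | h
  · exact h
  · exact absurd h hk.ne'

theorem aux_unique {n : ℕ} (hn : 1 ≤ n) (A : Matrix (Fin n) (Fin n) ℝ) (hA : ∀ i j, 0 ≤ A i j)
    (hirr : ∀ i j, ∃ k, 1 ≤ k ∧ 0 < (A ^ k) i j) (b c : Fin n → ℝ)
    (hc : ∀ i, 0 < c i) (hb1 : ∑ i, b i = 1) (hc1 : ∑ i, c i = 1)
    (hbf : b ᵥ* A = b) (hcf : c ᵥ* A = c) : b = c := by
  haveI : Nonempty (Fin n) := ⟨⟨0, hn⟩⟩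
  obtain ⟨i0, hi0⟩ := Finite.exists_min (fun i => b i / c i)
  set t := b i0 / c i0 with ht
  have hw : b - t • c = 0 := by
    apply aux_zero A hA hirr _ _ _ i0
    · have := (hc i0).ne'
      simp only [Pi.sub_apply, Pi.smul_apply, smul_eq_mul, ht]
      field_simp
      ring
    · intro i
      have := (le_div_iff₀ (hc i)).mp (hi0 i)
      simp only [Pi.sub_apply, Pi.smul_apply, smul_eq_mul]
      linarith
    · rw [Matrix.sub_vecMul, Matrix.smul_vecMul, hbf, hcf]
  have hb : b = t • c := sub_eq_zero.mp hw
  have ht1 : t = 1 := by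
    rw [hb] at hb1
    simp only [Pi.smul_apply, smul_eq_mul] at hb1
    rw [← Finset.mul_sum, hc1] at hb1
    linarith
  rw [hb, ht1, one_smul]

theorem aux_det {ι : Type*} [Fintype ι] [DecidableEq ι] (P : Matrix ι ι ℝ)
    (hP : ∀ i j, 0 ≤ P i j) (hP1 : ∀ i, ∑ j, P i j = 1) (lam : ℝ) (hl0 : 0 < lam)
    (hl1 : lam < 1) : IsUnit (1 - lam • P).det := by
  rw [isUnit_iff_ne_zero]
  apply det_ne_zero_of_sum_row_lt_diag
  intro k
  have h1 : ∑ j ∈ Finset.univ.erase k, ‖(1 - lam • P) k j‖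
      = ∑ j ∈ Finset.univ.erase k, lam * P k j := by
    apply Finset.sum_congr rfl
    intro j hj
    have hjk : k ≠ j := (Finset.ne_of_mem_erase hj).symm
    simp [Matrix.one_apply_ne hjk, abs_of_pos hl0, abs_of_nonneg (hP k j)]
  have h2 := Finset.add_sum_erase Finset.univ (fun j => P k j) (Finset.mem_univ k)
  simp only [hP1] at h2
  rw [h1, ← Finset.mul_sum]
  refine lt_of_lt_of_le ?_ (le_abs_self _)
  simp only [Matrix.sub_apply, Matrix.one_apply_eq, Matrix.smul_apply, smul_eq_mul]
  nlinarith

theorem aux_fix {ι : Type*} [Fintype ι] [DecidableEq ι] (P : Matrix ι ι ℝ)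
    (hP : ∀ i j, 0 ≤ P i j) (hP1 : ∀ i, ∑ j, P i j = 1) (lam : ℝ) (hl0 : 0 < lam)
    (hl1 : lam < 1) (v : ι → ℝ) :
    (1 - lam) • (v ᵥ* (1 - lam • P)⁻¹) = v ↔ v ᵥ* P = v := by
  have hu := aux_det P hP hP1 lam hl0 hl1
  constructor
  · intro h
    have h' := congrArg (fun w => w ᵥ* (1 - lam • P)) h
    beta_reduce at h'
    rw [Matrix.smul_vecMul, Matrix.vecMul_vecMul, Matrix.nonsing_inv_mul _ hu,
      Matrix.vecMul_one, Matrix.vecMul_sub, Matrix.vecMul_smul, Matrix.vecMul_one] at h'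
    funext i
    have := congrFun h' i
    simp only [Pi.sub_apply, Pi.smul_apply, smul_eq_mul] at this
    have h3 : lam * (v ᵥ* P) i = lam * v i := by linarith
    exact mul_left_cancel₀ hl0.ne' h3
  · intro h
    have h' : v ᵥ* (1 - lam • P) = (1 - lam) • v := by
      rw [Matrix.vecMul_sub, Matrix.vecMul_smul, h, Matrix.vecMul_one, sub_smul, one_smul]
    rw [← Matrix.smul_vecMul, ← h', Matrix.vecMul_vecMul, Matrix.mul_nonsing_inv _ hu,
      Matrix.vecMul_one]

theorem stmt15 {n₁ n₂ : ℕ} (h1 : 1 ≤ n₁) (h2 : 1 ≤ n₂)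
    (Q₁ : Matrix (Fin n₁) (Fin n₁) ℝ) (QB : Matrix (Fin n₁) (Fin n₂) ℝ)
    (P₂ : Matrix (Fin n₂) (Fin n₂) ℝ)
    (hQ₁0 : ∀ i j, 0 ≤ Q₁ i j)
    (hQ₁irr : ∀ i j, ∃ k, 1 ≤ k ∧ 0 < (Q₁ ^ k) i j)
    (hQB0 : ∀ i j, 0 ≤ QB i j) (hQBne : QB ≠ 0)
    (hjoint : ∀ i, (∑ j, Q₁ i j) + (∑ j, QB i j) = 1)
    (hP₂0 : ∀ i j, 0 ≤ P₂ i j) (hP₂1 : ∀ i, ∑ j, P₂ i j = 1)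
    (hP₂irr : ∀ i j, ∃ k, 1 ≤ k ∧ 0 < (P₂ ^ k) i j)
    (lam : ℝ) (hl0 : 0 < lam) (hl1 : lam < 1)
    (c₂ : Fin n₂ → ℝ) (hc₂pos : ∀ i, 0 < c₂ i) (hc₂sum : ∑ i, c₂ i = 1)
    (hc₂ : c₂ ᵥ* P₂ = c₂) :
    (¬ ∃ v : Fin n₁ ⊕ Fin n₂ → ℝ, (∀ i, 0 < v i) ∧ (∑ i, v i = 1) ∧
      (1 - lam) • (v ᵥ* (1 - lam • Matrix.fromBlocks Q₁ QB 0 P₂)⁻¹) = v) ∧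
    (∀ v : Fin n₁ ⊕ Fin n₂ → ℝ,
      ((∀ i, 0 ≤ v i) ∧ (∑ i, v i = 1) ∧
        (1 - lam) • (v ᵥ* (1 - lam • Matrix.fromBlocks Q₁ QB 0 P₂)⁻¹) = v) ↔
      v = Sum.elim (0 : Fin n₁ → ℝ) c₂) := by
  have hP : ∀ i j, 0 ≤ Matrix.fromBlocks Q₁ QB 0 P₂ i j := by
    rintro (i | i) (j | j) <;> simp [hQ₁0, hQB0, hP₂0]
  have hP1 : ∀ i, ∑ j, Matrix.fromBlocks Q₁ QB 0 P₂ i j = 1 := by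
    rintro (i | i) <;> simp [Fintype.sum_sum_type, hjoint, hP₂1]
  have key : ∀ v : Fin n₁ ⊕ Fin n₂ → ℝ,
      ((∀ i, 0 ≤ v i) ∧ (∑ i, v i = 1) ∧
        (1 - lam) • (v ᵥ* (1 - lam • Matrix.fromBlocks Q₁ QB 0 P₂)⁻¹) = v) ↔
      v = Sum.elim (0 : Fin n₁ → ℝ) c₂ := by
    intro v
    rw [aux_fix _ hP hP1 lam hl0 hl1]
    constructor
    · rintro ⟨hv0, hv1, hv⟩
      obtain ⟨a, b, rfl⟩ : ∃ a b, v = Sum.elim a b :=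
        ⟨v ∘ Sum.inl, v ∘ Sum.inr, (Sum.elim_comp_inl_inr v).symm⟩
      have ha0 : ∀ i, 0 ≤ a i := fun i => hv0 (Sum.inl i)
      rw [Matrix.vecMul_fromBlocks] at hv
      have hva : a ᵥ* Q₁ = a := by
        funext i
        have := congrFun hv (Sum.inl i)
        simpa using this
      have hvb : a ᵥ* QB + b ᵥ* P₂ = b := by
        funext i
        have := congrFun hv (Sum.inr i)
        simpa using this
      have hsumP : ∑ j, (b ᵥ* P₂) j = ∑ j, b j := by
        simp only [Matrix.vecMul, dotProduct]
        rw [Finset.sum_comm]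
        simp [← Finset.mul_sum, hP₂1]
      have hs0 : ∑ j, (a ᵥ* QB) j = 0 := by
        have h := congrArg (fun w => ∑ j, w j) hvb
        simp only [Pi.add_apply, Finset.sum_add_distrib] at h
        linarith
      have hnn : ∀ i j, 0 ≤ a i * QB i j := fun i j => mul_nonneg (ha0 i) (hQB0 i j)
      have hterm : ∀ i j, a i * QB i j = 0 := by
        intro i j
        simp only [Matrix.vecMul, dotProduct] at hs0
        rw [Finset.sum_eq_zero_iff_of_nonneg
          fun l _ => Finset.sum_nonneg fun m _ => hnn m l] at hs0
        have h := hs0 j (Finset.mem_univ j)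
        rw [Finset.sum_eq_zero_iff_of_nonneg fun m _ => hnn m j] at h
        exact h i (Finset.mem_univ i)
      obtain ⟨i0, j0, hij⟩ : ∃ i j, QB i j ≠ 0 := by
        by_contra! hcon
        exact hQBne (by ext i j; simpa using hcon i j)
      have ha : a = 0 := aux_zero Q₁ hQ₁0 hQ₁irr a ha0 hva i0
        ((mul_eq_zero.mp (hterm i0 j0)).resolve_right hij)
      subst ha
      have hb : b = c₂ := by
        apply aux_unique h2 P₂ hP₂0 hP₂irr b c₂ hc₂pos _ hc₂sum _ hc₂
        · simpa [Fintype.sum_sum_type] using hv1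
        · simpa using hvb
      rw [hb]
    · rintro rfl
      refine ⟨?_, ?_, ?_⟩
      · rintro (i | i)
        · simp
        · exact (hc₂pos i).le
      · simpa [Fintype.sum_sum_type] using hc₂sum
      · rw [Matrix.vecMul_fromBlocks]
        simp [hc₂]
  refine ⟨?_, key⟩
  rintro ⟨v, hv0, hv1, hv⟩
  have h := (key v).mp ⟨fun i => (hv0 i).le, hv1, hv⟩
  have h3 := hv0 (Sum.inl ⟨0, h1⟩)
  rw [h] at h3
  simp at h3
end

section
/- Let P be an N×N row-stochastic matrix and suppose the index set {1,…,N} is partitioned into nonempty classes C₁,…,C_L, D₁,…,D_M (in this order, L ≥ 0, M ≥ 1) such that: (a) P_{ij} = 0 whenever the class of i comes strictly later in this order than the class of j (block upper-triangularity); (b) for each j = 1,…,M, the submatrix of P on D_j × D_j is irreducible and P_{uv} = 0 for every u ∈ D_j and v ∉ D_j (so each D_j block is row-stochastic: the D_j are the dangling clusters); (c) for each i = 1,…,L, the submatrix of P on C_i × C_i is either irreducible or the 1×1 zero matrix, and there exist u ∈ C_i and v ∉ C_i with P_{uv} > 0. Let λ ∈ (0,1), let X(λ) = (1−λ)(I −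 λP)⁻¹, and for each j let c_j be a left Perron vector of the D_j-block of P. Then for every v ∈ ℝ^N with all entries positive and Σᵢ vᵢ = 1, the sequence xₖᵀ = vᵀX(λ)^k converges as k → ∞ to a vector x ∈ ℝ^N such that x_i = 0 for every i belonging to some class C₁,…,C_L, and there exist α₁,…,α_M ≥ 0 with α₁ + ⋯ + α_M = 1 such that the restriction of x to D_j equals α_j c_j for every j = 1,…,M. -/
open Matrix Filter Topology

/-- A nonnegative square matrix is irreducible: for every pair of indices there is a
power `k ≥ 1` with positive `(i,j)` entry. -/
def IsIrred {n : Type*} [Fintype n] [DecidableEq n] (M : Matrix n n ℝ) : Prop :=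
  ∀ i j, ∃ k, 1 ≤ k ∧ 0 < (M ^ k) i j

/-- The block (submatrix) of `P` on the class `{i | g i = s}`. -/
def blockOf {N m : ℕ} (P : Matrix (Fin N) (Fin N) ℝ) (g : Fin N → Fin m) (s : Fin m) :
    Matrix {i : Fin N // g i = s} {i : Fin N // g i = s} ℝ :=
  Matrix.of fun u v => P u.1 v.1

/-- Row-stochastic matrices. -/
def RowSt {N : ℕ} (P : Matrix (Fin N) (Fin N) ℝ) : Prop :=
  (∀ i j, 0 ≤ P i j) ∧ ∀ i, ∑ j, P i j = 1

lemma RowSt.mul {N : ℕ} {P Q : Matrix (Fin N) (Fin N) ℝ} (hP : RowSt P) (hQ : RowSt Q) :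
    RowSt (P * Q) := by
  refine ⟨fun i j => ?_, fun i => ?_⟩
  · rw [Matrix.mul_apply]
    exact Finset.sum_nonneg fun k _ => mul_nonneg (hP.1 i k) (hQ.1 k j)
  · simp only [Matrix.mul_apply]
    rw [Finset.sum_comm]
    simp only [← Finset.mul_sum, hQ.2, mul_one, hP.2]

lemma RowSt.one {N : ℕ} : RowSt (1 : Matrix (Fin N) (Fin N) ℝ) := by
  refine ⟨fun i j => ?_, fun i => ?_⟩
  · rw [Matrix.one_apply]; split_ifs <;> norm_num
  · simp [Matrix.one_apply]

lemma RowSt.pow {N : ℕ} {P : Matrix (Fin N) (Fin N) ℝ} (hP : RowSt P) (k : ℕ) :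
    RowSt (P ^ k) := by
  induction k with
  | zero => rw [pow_zero]; exact RowSt.one
  | succ k ih => rw [pow_succ]; exact ih.mul hP

lemma RowSt.le_one {N : ℕ} {P : Matrix (Fin N) (Fin N) ℝ} (hP : RowSt P) (i j) : P i j ≤ 1 := by
  rw [← hP.2 i]
  exact Finset.single_le_sum (f := fun j => P i j) (fun k _ => hP.1 i k) (Finset.mem_univ j)

lemma RowSt.lim {N : ℕ} {F : ℕ → Matrix (Fin N) (Fin N) ℝ} (hF : ∀ n, RowSt (F n))
    {E : Matrix (Fin N) (Fin N) ℝ} (h : Tendsto F atTop (𝓝 E)) : RowSt E := by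
  have he : ∀ i j, Tendsto (fun n => F n i j) atTop (𝓝 (E i j)) := fun i j =>
    (tendsto_pi_nhds.1 ((tendsto_pi_nhds.1 h) i)) j
  refine ⟨fun i j => ge_of_tendsto' (he i j) fun n => (hF n).1 i j, fun i => ?_⟩
  have h2 := tendsto_finsetSum Finset.univ (fun j _ => he i j)
  simp only [(hF _).2] at h2
  exact tendsto_nhds_unique h2 tendsto_const_nhds

attribute [local instance] Matrix.normedAddCommGroup Matrix.normedSpace

lemma abs_entry_le {N : ℕ} {P Z : Matrix (Fin N) (Fin N) ℝ} (hP : RowSt P) {d : ℝ}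
    (hZ : ∀ i j, |Z i j| ≤ d) (i j) : |(P * Z) i j| ≤ d := by
  rw [Matrix.mul_apply]
  calc |∑ k, P i k * Z k j| ≤ ∑ k, |P i k * Z k j| := Finset.abs_sum_le_sum_abs _ _
    _ ≤ ∑ k, P i k * d := by
        refine Finset.sum_le_sum fun k _ => ?_
        rw [abs_mul, abs_of_nonneg (hP.1 i k)]
        exact mul_le_mul_of_nonneg_left (hZ k j) (hP.1 i k)
    _ = d := by rw [← Finset.sum_mul, hP.2, one_mul]

lemma abs_entry_le_norm {N : ℕ} (Z : Matrix (Fin N) (Fin N) ℝ) (i j) : |Z i j| ≤ ‖Z‖ :=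
  Matrix.norm_entry_le_entrywise_sup_norm Z

lemma norm_mul_le_st {N : ℕ} {P Z : Matrix (Fin N) (Fin N) ℝ} (hP : RowSt P) :
    ‖P * Z‖ ≤ ‖Z‖ :=
  (Matrix.norm_le_iff (norm_nonneg _)).2 fun i j =>
    abs_entry_le hP (abs_entry_le_norm Z) i j

/-- if the norms of `X^n Z` never decrease, an extremal entry is constant along the orbit -/
lemma extremal {N : ℕ} {X S Z : Matrix (Fin N) (Fin N) ℝ} {a b : ℝ} (ha : 0 < a) (hb : 0 < b)
    (hab : a + b = 1) (hS : RowSt S) (hX : X = a • 1 + b • S) (d : ℝ)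
    (hZ : ∀ n : ℕ, ∀ i j, |(X ^ n * Z) i j| ≤ d) (i j : Fin N) (s : ℝ) (hs : s = 1 ∨ s = -1)
    (m : ℕ) (hm : s * (X ^ m * Z) i j = d) : ∀ n ≤ m, s * (X ^ n * Z) i j = d := by
  induction m with
  | zero => intro n hn; obtain rfl : n = 0 := by omega
            exact hm
  | succ m ih =>
    have h1 : (X ^ (m + 1) * Z) i j = a * (X ^ m * Z) i j + b * (S * (X ^ m * Z)) i j := by
      rw [pow_succ', Matrix.mul_assoc]
      nth_rewrite 1 [hX]
      rw [Matrix.add_mul, Matrix.smul_mul, Matrix.smul_mul, Matrix.one_mul]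
      simp
    have h2 := abs_le.1 (hZ m i j)
    have h3 := abs_le.1 (abs_entry_le hS (hZ m) i j)
    have h4 : s * (X ^ m * Z) i j = d := by
      rw [h1] at hm
      have h5 : s * (S * (X ^ m * Z)) i j ≤ d := by rcases hs with rfl | rfl <;> linarith
      have h6 : s * (X ^ m * Z) i j ≤ d := by rcases hs with rfl | rfl <;> linarith
      have e : a * (s * (X ^ m * Z) i j) + b * (s * (S * (X ^ m * Z)) i j) = (a + b) * d := by
        rw [hab]; linarith
      have := mul_le_mul_of_nonneg_left h5 hb.le
      have h7 : a * d ≤ a * (s * (X ^ m * Z) i j) := by linarith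
      exact le_antisymm h6 (le_of_mul_le_mul_left h7 ha)
    intro n hn
    rcases Nat.lt_or_ge n (m + 1) with h | h
    · exact ih h4 n (by omega)
    · obtain rfl : n = m + 1 := by omega
      exact hm

lemma limpt {N : ℕ} {X S : Matrix (Fin N) (Fin N) ℝ} {a b : ℝ} (ha : 0 < a) (hb : 0 < b)
    (hab : a + b = 1) (hXs : RowSt X) (hS : RowSt S) (hX : X = a • 1 + b • S)
    (φ : ℕ → ℕ) (hφ : StrictMono φ) (Y : Matrix (Fin N) (Fin N) ℝ)
    (hY : Tendsto (fun n => X ^ φ n) atTop (𝓝 Y)) : X * Y = Y ∧ Y * X = Y := by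
  have hYs : RowSt Y := RowSt.lim (fun n => hXs.pow _) hY
  have hcomm : X * Y = Y * X := by
    have h1 : Tendsto (fun n => X * X ^ φ n) atTop (𝓝 (X * Y)) := tendsto_const_nhds.mul hY
    have h2 : Tendsto (fun n => X ^ φ n * X) atTop (𝓝 (Y * X)) := hY.mul tendsto_const_nhds
    simp only [← pow_succ] at h2
    simp only [← pow_succ'] at h1
    exact tendsto_nhds_unique h1 h2
  suffices h : X * Y = Y from ⟨h, hcomm ▸ h⟩
  set D : ℕ → ℝ := fun k => ‖X ^ k * (X - 1)‖ with hD
  have hanti : Antitone D := antitone_nat_of_succ_le fun k => by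
    simp only [hD, pow_succ', Matrix.mul_assoc]
    exact norm_mul_le_st hXs
  have hlim := tendsto_atTop_ciInf hanti ⟨0, by rintro _ ⟨k, rfl⟩; exact norm_nonneg _⟩
  set d := ⨅ i, D i
  set Z := (X - 1) * Y with hZ
  have hcXY : Y * (X - 1) = (X - 1) * Y := by
    rw [Matrix.mul_sub, Matrix.sub_mul, hcomm]; simp
  have hnorm : ∀ n, ‖X ^ n * Z‖ = d := fun n => by
    have h1 : Tendsto (fun j => X ^ n * (X ^ φ j * (X - 1))) atTop (𝓝 (X ^ n * Z)) := by
      rw [hZ, ← hcXY]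
      exact tendsto_const_nhds.mul (hY.mul tendsto_const_nhds)
    have h2 := h1.norm
    have h3 : Tendsto (fun j => D (n + φ j)) atTop (𝓝 d) :=
      hlim.comp (tendsto_atTop_mono (fun j => Nat.le_add_left _ _) hφ.tendsto_atTop)
    simp only [hD, pow_add, Matrix.mul_assoc] at h3
    exact tendsto_nhds_unique h2 h3
  have hle : ∀ n : ℕ, ∀ i j, |(X ^ n * Z) i j| ≤ d := fun n i j =>
    (abs_entry_le_norm _ i j).trans (hnorm n).le
  have hd : d = 0 := by
    by_contra hd0
    have hdpos : 0 < d := lt_of_le_of_ne (hnorm 0 ▸ norm_nonneg _) (Ne.symm hd0)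
    obtain ⟨m, hm⟩ := exists_nat_gt (1 / d)
    have hex : ∃ i j, d ≤ |(X ^ m * Z) i j| := by
      by_contra hcon
      push Not at hcon
      have := (Matrix.norm_lt_iff hdpos (A := X ^ m * Z)).2 fun i j => hcon i j
      rw [hnorm] at this
      exact lt_irrefl _ this
    obtain ⟨i, j, hij⟩ := hex
    have habs := le_antisymm (hle m i j) hij
    obtain ⟨s, hs, hsd⟩ : ∃ s : ℝ, (s = 1 ∨ s = -1) ∧ s * (X ^ m * Z) i j = d := by
      rcases abs_choice ((X ^ m * Z) i j) with h | h
      · exact ⟨1, Or.inl rfl, by rw [one_mul, ← h, habs]⟩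
      · exact ⟨-1, Or.inr rfl, by rw [neg_one_mul, ← h, habs]⟩
    have hall := extremal ha hb hab hS hX d hle i j s hs m hsd
    have htel : ∀ n, n ≤ m → s * ((X ^ n * Y) i j - Y i j) = n * d := by
      intro n
      induction n with
      | zero => intro _; simp
      | succ n ih =>
        intro hn
        have h1 := ih (by omega)
        have h2 := hall n (by omega)
        have h3 : X ^ (n + 1) * Y = X ^ n * Z + X ^ n * Y := by
          rw [hZ, Matrix.sub_mul, Matrix.mul_sub, pow_succ, Matrix.mul_assoc]; simp
        rw [h3, Matrix.add_apply]
        push_cast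
        linarith
    have h1 := htel m le_rfl
    have hYm := (hXs.pow m).mul hYs
    have a1 := hYm.1 i j
    have a2 := hYm.le_one i j
    have a3 := hYs.1 i j
    have a4 := hYs.le_one i j
    rw [div_lt_iff₀ hdpos] at hm
    rcases hs with rfl | rfl <;> linarith
  have hZ0 : Z = 0 := by
    have := hnorm 0
    rw [pow_zero, Matrix.one_mul, hd] at this
    exact norm_eq_zero.1 this
  rw [hZ, Matrix.sub_mul, Matrix.one_mul] at hZ0
  exact sub_eq_zero.1 hZ0

lemma conv_pow {N : ℕ} {X S : Matrix (Fin N) (Fin N) ℝ} {a b : ℝ} (ha : 0 < a) (hb : 0 < b)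
    (hab : a + b = 1) (hXs : RowSt X) (hS : RowSt S) (hX : X = a • 1 + b • S) :
    ∃ E, Tendsto (fun n => X ^ n) atTop (𝓝 E) ∧ RowSt E ∧ E * X = E := by
  have hcpt : IsCompact {Y : Matrix (Fin N) (Fin N) ℝ | ∀ i, Y i ∈ {y : Fin N → ℝ | ∀ j, y j ∈ Set.Icc (0:ℝ) 1}} :=
    isCompact_pi_infinite fun i => isCompact_pi_infinite fun j => isCompact_Icc
  have hmem : ∀ k, X ^ k ∈ {Y : Matrix (Fin N) (Fin N) ℝ | ∀ i, Y i ∈ {y : Fin N → ℝ | ∀ j, y j ∈ Set.Icc (0:ℝ) 1}} :=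
    fun k i j => ⟨(hXs.pow k).1 i j, (hXs.pow k).le_one i j⟩
  have : FirstCountableTopology (Matrix (Fin N) (Fin N) ℝ) :=
    inferInstanceAs (FirstCountableTopology (Fin N → Fin N → ℝ))
  obtain ⟨E, -, φ, hφ, hE⟩ := hcpt.tendsto_subseq hmem
  have hE1 := limpt ha hb hab hXs hS hX φ hφ E hE
  refine ⟨E, ?_, RowSt.lim (fun n => hXs.pow _) hE, hE1.2⟩
  refine tendsto_of_subseq_tendsto fun ns hns => ?_
  obtain ⟨F, -, ψ, hψ, hF⟩ := hcpt.tendsto_subseq (x := fun k => X ^ ns k) fun k => hmem _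
  -- pass to a strictly monotone subsequence of indices
  obtain ⟨θ, hθ, hθ2⟩ := strictMono_subseq_of_tendsto_atTop (hns.comp hψ.tendsto_atTop)
  have hF' := hF.comp hθ.tendsto_atTop
  have hF1 := limpt ha hb hab hXs hS hX _ hθ2 F hF'
  have hXF : ∀ k, X ^ k * F = F := fun k => by
    induction k with
    | zero => simp
    | succ k ih => rw [pow_succ, Matrix.mul_assoc, hF1.1, ih]
  have hEX : ∀ k, E * X ^ k = E := fun k => by
    induction k with
    | zero => simp
    | succ k ih => rw [pow_succ, ← Matrix.mul_assoc, ih, hE1.2]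
  have e1 : E * F = F := by
    have : Tendsto (fun n => X ^ φ n * F) atTop (𝓝 (E * F)) := hE.mul tendsto_const_nhds
    simp only [hXF] at this
    exact tendsto_nhds_unique this tendsto_const_nhds
  have e2 : E * F = E := by
    have : Tendsto (fun n => E * X ^ ns (ψ n)) atTop (𝓝 (E * F)) := tendsto_const_nhds.mul hF
    simp only [hEX] at this
    exact tendsto_nhds_unique this tendsto_const_nhds
  exact ⟨ψ, by rw [← e2, e1]; exact hF⟩

lemma irred_zero {n : Type*} [Fintype n] [DecidableEq n] {B : Matrix n n ℝ} (hB : IsIrred B)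
    (hB0 : ∀ i j, 0 ≤ B i j) (y : n → ℝ) (hy : ∀ i, 0 ≤ y i) (hyB : y ᵥ* B = y) (u : n)
    (hu : y u = 0) : ∀ i, y i = 0 := by
  intro i
  have hpow : ∀ k, y ᵥ* B ^ k = y := fun k => by
    induction k with
    | zero => simp
    | succ k ih => rw [pow_succ, ← Matrix.vecMul_vecMul, ih, hyB]
  have hpn : ∀ k i j, 0 ≤ (B ^ k) i j := fun k => by
    induction k with
    | zero => intro i j; rw [pow_zero, Matrix.one_apply]; split_ifs <;> norm_num
    | succ k ih =>
      intro i j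
      rw [pow_succ, Matrix.mul_apply]
      exact Finset.sum_nonneg fun l _ => mul_nonneg (ih i l) (hB0 l j)
  obtain ⟨k, -, hk⟩ := hB i u
  have h1 := congrFun (hpow k) u
  rw [hu] at h1
  simp only [Matrix.vecMul, dotProduct] at h1
  have h2 := (Finset.sum_eq_zero_iff_of_nonneg
    (fun l _ => mul_nonneg (hy l) (hpn k l u))).1 h1 i (Finset.mem_univ i)
  rcases mul_eq_zero.1 h2 with h | h
  · exact h
  · exact absurd h hk.ne'

lemma irred_prop {n : Type*} [Fintype n] [DecidableEq n] [Nonempty n] {B : Matrix n n ℝ}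
    (hB : IsIrred B) (hB0 : ∀ i j, 0 ≤ B i j) (y c : n → ℝ) (hy : ∀ i, 0 ≤ y i)
    (hyB : y ᵥ* B = y) (hc : ∀ i, 0 < c i) (hcB : c ᵥ* B = c) :
    ∃ t : ℝ, 0 ≤ t ∧ ∀ i, y i = t * c i := by
  obtain ⟨u, -, hu⟩ := Finset.exists_min_image Finset.univ (fun i => y i / c i)
    Finset.univ_nonempty
  refine ⟨y u / c u, div_nonneg (hy u) (hc u).le, fun i => ?_⟩
  have := irred_zero hB hB0 (y - (y u / c u) • c) (fun i => ?_) ?_ u ?_ i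
  · simp at this; linarith
  · have h := hu i (Finset.mem_univ i)
    rw [le_div_iff₀ (hc i)] at h
    simp; linarith
  · rw [Matrix.sub_vecMul, Matrix.smul_vecMul, hyB, hcB]
  · have := (hc u).ne'
    simp; field_simp; simp

lemma resolv_st {N : ℕ} {P : Matrix (Fin N) (Fin N) ℝ} (hP : RowSt P) (lam : ℝ) (hl0 : 0 < lam)
    (hl1 : lam < 1) :
    let X := (1 - lam) • (1 - lam • P)⁻¹
    RowSt X ∧ X = (1 - lam) • 1 + lam • (P * X) ∧ X * (1 - lam • P) = (1 - lam) • 1 := by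
  intro X
  have hdet : (1 - lam • P).det ≠ 0 := by
    refine det_ne_zero_of_sum_row_lt_diag fun k => ?_
    have h1 : ∑ j ∈ Finset.univ.erase k, ‖(1 - lam • P) k j‖
        = ∑ j ∈ Finset.univ.erase k, lam * P k j := by
      refine Finset.sum_congr rfl fun j hj => ?_
      have : k ≠ j := (Finset.ne_of_mem_erase hj).symm
      simp [Matrix.one_apply_ne this, abs_of_pos hl0, abs_of_nonneg (hP.1 k j)]
    rw [h1, ← Finset.mul_sum]
    have h2 := Finset.add_sum_erase Finset.univ (fun j => P k j) (Finset.mem_univ k)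
    simp only [hP.2] at h2
    have h3 : (1 - lam • P) k k = 1 - lam * P k k := by simp
    rw [h3]
    refine lt_of_lt_of_le ?_ (le_abs_self _)
    have h4 : ∑ j ∈ Finset.univ.erase k, P k j = 1 - P k k := by linarith
    rw [h4]; linarith
  have hu : IsUnit (1 - lam • P).det := isUnit_iff_ne_zero.2 hdet
  have hR : X * (1 - lam • P) = (1 - lam) • 1 := by
    simp only [X, Matrix.smul_mul, Matrix.nonsing_inv_mul _ hu]
  have hL : (1 - lam • P) * X = (1 - lam) • 1 := by
    simp only [X, Matrix.mul_smul, Matrix.mul_nonsing_inv _ hu]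
  have hX : X = (1 - lam) • 1 + lam • (P * X) := by
    rw [← hL, Matrix.sub_mul, Matrix.one_mul, Matrix.smul_mul]; simp
  refine ⟨⟨fun i j => ?_, fun i => ?_⟩, hX, hR⟩
  · obtain ⟨u, -, hu⟩ := Finset.exists_min_image Finset.univ (fun i => X i j)
      ⟨i, Finset.mem_univ i⟩
    refine le_trans ?_ (hu i (Finset.mem_univ i))
    have h1 : X u j = (1 - lam) * (1 : Matrix (Fin N) (Fin N) ℝ) u j + lam * (P * X) u j := by
      conv_lhs => rw [hX]
      simp
    have h2 : X u j ≤ (P * X) u j := by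
      rw [Matrix.mul_apply]
      calc X u j = ∑ k, P u k * X u j := by rw [← Finset.sum_mul, hP.2, one_mul]
        _ ≤ _ := Finset.sum_le_sum fun k _ =>
          mul_le_mul_of_nonneg_left (hu k (Finset.mem_univ k)) (hP.1 u k)
    have h3 := mul_nonneg (sub_nonneg.2 hl1.le) ((RowSt.one (N := N)).1 u j)
    have h4 := mul_le_mul_of_nonneg_left h2 hl0.le
    by_contra hneg
    push Not at hneg
    nlinarith
  · have h1 : (1 - lam • P) *ᵥ (fun _ => (1 : ℝ)) = (1 - lam) • (fun _ => (1 : ℝ)) := by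
      rw [Matrix.sub_mulVec, Matrix.one_mulVec, Matrix.smul_mulVec]
      ext k
      simp [Matrix.mulVec, dotProduct, hP.2]
    have h2 := congrArg (fun w => X *ᵥ w) h1
    simp only [Matrix.mulVec_mulVec, hR, Matrix.mulVec_smul, Matrix.smul_mulVec,
      Matrix.one_mulVec] at h2
    have h3 := congrFun h2 i
    simp [Matrix.mulVec, dotProduct] at h3
    have h4 : (1 - lam) * ∑ j, X i j = (1 - lam) * 1 := by linarith
    exact mul_left_cancel₀ (sub_pos.2 hl1).ne' h4

theorem stmt16 {N L M : ℕ} (hM : 1 ≤ M)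
    (P : Matrix (Fin N) (Fin N) ℝ)
    (hP0 : ∀ i j, 0 ≤ P i j) (hP1 : ∀ i, ∑ j, P i j = 1)
    (g : Fin N → Fin (L + M)) (hg : Function.Surjective g)
    -- (a) block upper-triangularity with respect to the order of the classes
    (hupper : ∀ i j, g j < g i → P i j = 0)
    -- (b) each dangling block is irreducible and has no links leaving it
    (hDirr : ∀ dj : Fin M, IsIrred (blockOf P g (Fin.natAdd L dj)))
    (hDdangling : ∀ (dj : Fin M) (u v : Fin N),
      g u = Fin.natAdd L dj → g v ≠ Fin.natAdd L dj → P u v = 0)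
    -- (c) each non-dangling block is irreducible or a 1×1 zero matrix, and has a link leaving it
    (hCblock : ∀ ci : Fin L,
      IsIrred (blockOf P g (Fin.castAdd M ci)) ∨
        (Fintype.card {i : Fin N // g i = Fin.castAdd M ci} = 1 ∧
          ∀ u, g u = Fin.castAdd M ci → P u u = 0))
    (hCleave : ∀ ci : Fin L,
      ∃ u v : Fin N, g u = Fin.castAdd M ci ∧ g v ≠ Fin.castAdd M ci ∧ 0 < P u v)
    (lam : ℝ) (hl0 : 0 < lam) (hl1 : lam < 1)
    -- left Perron vectors of the dangling blocks
    (c : ∀ dj : Fin M, {i : Fin N // g i = Fin.natAdd L dj} → ℝ)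
    (hcpos : ∀ dj u, 0 < c dj u) (hcsum : ∀ dj, ∑ u, c dj u = 1)
    (hcperron : ∀ dj, c dj ᵥ* blockOf P g (Fin.natAdd L dj) = c dj)
    (v : Fin N → ℝ) (hv : ∀ i, 0 < v i) (hvsum : ∑ i, v i = 1) :
    ∃ x : Fin N → ℝ,
      Tendsto (fun k : ℕ => v ᵥ* (((1 - lam) • (1 - lam • P)⁻¹) ^ k)) atTop (𝓝 x) ∧
      (∀ i : Fin N, (g i : ℕ) < L → x i = 0) ∧
      ∃ α : Fin M → ℝ, (∀ dj, 0 ≤ α dj) ∧ (∑ dj, α dj = 1) ∧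
        ∀ (dj : Fin M) (u : Fin N) (hu : g u = Fin.natAdd L dj),
          x u = α dj * c dj ⟨u, hu⟩ := by
  have hP : RowSt P := ⟨hP0, hP1⟩
  obtain ⟨hXs, hX, hR⟩ := resolv_st hP lam hl0 hl1
  set X := (1 - lam) • (1 - lam • P)⁻¹
  obtain ⟨E, hE, hEs, hEX⟩ := conv_pow (sub_pos.2 hl1) hl0 (by ring) hXs (hP.mul hXs) hX
  set x := v ᵥ* E with hx
  have hx0 : ∀ i, 0 ≤ x i := fun i => by
    simp only [hx, Matrix.vecMul, dotProduct]
    exact Finset.sum_nonneg fun k _ => mul_nonneg (hv k).le (hEs.1 k i)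
  have hxsum : ∑ i, x i = 1 := by
    simp only [hx, Matrix.vecMul, dotProduct]
    rw [Finset.sum_comm]
    simp only [← Finset.mul_sum, hEs.2, mul_one, hvsum]
  have hxX : x ᵥ* X = x := by rw [hx, Matrix.vecMul_vecMul, hEX]
  have hxP : x ᵥ* P = x := by
    have h1 : x ᵥ* (X * (1 - lam • P)) = (1 - lam) • x := by
      rw [hR, Matrix.vecMul_smul, Matrix.vecMul_one]
    rw [← Matrix.vecMul_vecMul, hxX, Matrix.vecMul_sub, Matrix.vecMul_one,
      Matrix.vecMul_smul] at h1
    ext i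
    have h2 := congrFun h1 i
    simp at h2
    have h3 : lam * (x ᵥ* P) i = lam * x i := by linarith
    exact mul_left_cancel₀ hl0.ne' h3
  have hxPi : ∀ j, ∑ i, x i * P i j = x j := fun j => congrFun hxP j
  -- restriction to a class
  have hsub : ∀ (s : Fin (L + M)) (f : Fin N → ℝ), (∀ i, g i ≠ s → f i = 0) →
      ∑ i : {i : Fin N // g i = s}, f i.1 = ∑ i, f i := fun s f hf => by
    rw [← Finset.sum_subtype (Finset.univ.filter fun i => g i = s) (by simp) f, Finset.sum_filter]
    refine Finset.sum_congr rfl fun i _ => ?_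
    split_ifs with h
    · rfl
    · exact (hf i h).symm
  have hres : ∀ s : Fin (L + M), (∀ i j, g j = s → g i ≠ s → x i * P i j = 0) →
      (fun u : {i : Fin N // g i = s} => x u.1) ᵥ* blockOf P g s = fun u => x u.1 := fun s hs => by
    ext u
    simp only [Matrix.vecMul, dotProduct, blockOf, Matrix.of_apply]
    rw [hsub s (fun i => x i * P i u.1) (fun i hi => hs i u.1 u.2 hi), hxPi]
  have hB0 : ∀ s u w, 0 ≤ blockOf P g s u w := fun s u w => hP0 _ _
  have hC : ∀ n : ℕ, n < L → ∀ i, (g i : ℕ) = n → x i = 0 := by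
    intro n
    induction n using Nat.strong_induction_on with
    | _ n ih =>
    intro hn
    set s : Fin (L + M) := Fin.castAdd M ⟨n, hn⟩ with hs
    have hsv : (s : ℕ) = n := rfl
    have hz : ∀ i j, g j = s → g i ≠ s → x i * P i j = 0 := by
      intro i j hj hi
      rcases lt_or_gt_of_ne hi with h | h
      · rw [ih (g i) (by rw [← hsv]; exact h) (by have : (g i : ℕ) < s := h
                                                  omega) i rfl, zero_mul]
      · rw [hupper i j (by rw [hj]; exact h), mul_zero]
    have hyB := hres s hz
    obtain ⟨u, w, hu, hw, huw⟩ := hCleave ⟨n, hn⟩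
    have hxu : x u = 0 := by
      have h1 : ∑ j ∈ Finset.univ.filter (fun j => g j = s), ∑ i, x i * P i j
          = ∑ j ∈ Finset.univ.filter (fun j => g j = s), x j :=
        Finset.sum_congr rfl fun j _ => hxPi j
      have h2 : ∑ j ∈ Finset.univ.filter (fun j => g j = s), ∑ i, x i * P i j
          = ∑ i ∈ Finset.univ.filter (fun j => g j = s),
              x i * ∑ j ∈ Finset.univ.filter (fun j => g j = s), P i j := by
        rw [Finset.sum_comm, Finset.sum_filter]
        refine Finset.sum_congr rfl fun i _ => ?_
        split_ifs with h
        · rw [Finset.mul_sum]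
        · exact Finset.sum_eq_zero fun j hj => hz i j (Finset.mem_filter.1 hj).2 h
      have h3 : ∑ i ∈ Finset.univ.filter (fun j => g j = s),
          x i * (1 - ∑ j ∈ Finset.univ.filter (fun j => g j = s), P i j) = 0 := by
        simp only [mul_sub, mul_one, Finset.sum_sub_distrib]
        linarith
      have hle : ∀ i, ∑ j ∈ Finset.univ.filter (fun j => g j = s), P i j ≤ 1 := fun i => by
        rw [← hP1 i]
        exact Finset.sum_le_sum_of_subset_of_nonneg (Finset.filter_subset _ _)
          fun j _ _ => hP0 i j
      have h4 := (Finset.sum_eq_zero_iff_of_nonneg (fun i _ =>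
        mul_nonneg (hx0 i) (sub_nonneg.2 (hle i)))).1 h3 u (by simp [hu, hs])
      rcases mul_eq_zero.1 h4 with h | h
      · exact h
      · exfalso
        have h5 : ∑ j ∈ Finset.univ.filter (fun j => g j = s), P u j < ∑ j, P u j :=
          Finset.sum_lt_sum_of_subset (Finset.filter_subset _ _) (Finset.mem_univ w)
            (by simpa [hs] using hw) huw fun j _ _ => hP0 u j
        rw [hP1] at h5
        linarith
    intro i hi
    have hgi : g i = s := Fin.ext hi
    rcases hCblock ⟨n, hn⟩ with hirr | ⟨hcard, -⟩
    · exact irred_zero hirr (hB0 s) _ (fun u => hx0 u.1) hyB ⟨u, hu⟩ hxu ⟨i, hgi⟩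
    · obtain ⟨a, ha⟩ := Fintype.card_eq_one_iff.1 hcard
      have := (ha ⟨i, hgi⟩).trans (ha ⟨u, hu⟩).symm
      rw [Subtype.mk.injEq] at this
      rw [this, hxu]
  have hD : ∀ dj : Fin M, ∃ t : ℝ, 0 ≤ t ∧ ∀ u : {i : Fin N // g i = Fin.natAdd L dj},
      x u.1 = t * c dj u := fun dj => by
    have : Nonempty {i : Fin N // g i = Fin.natAdd L dj} := by
      obtain ⟨i, hi⟩ := hg (Fin.natAdd L dj)
      exact ⟨⟨i, hi⟩⟩
    refine irred_prop (hDirr dj) (hB0 _) (fun u => x u.1) (c dj) (fun u => hx0 _)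
      (hres _ ?_) (hcpos dj) (hcperron dj)
    intro i j hj hi
    by_cases hlt : (g i : ℕ) < L
    · rw [hC _ hlt i rfl, zero_mul]
    · obtain ⟨k, hk⟩ : ∃ k : Fin M, g i = Fin.natAdd L k :=
        ⟨⟨g i - L, by have := (g i).2; omega⟩, Fin.ext (by simp; omega)⟩
      rw [hDdangling k i j hk (by rw [hj, ← hk]; exact hi.symm), mul_zero]
  choose α hα0 hα using hD
  refine ⟨x, ?_, fun i hi => hC _ hi i rfl, α, hα0, ?_, fun dj u hu => hα dj ⟨u, hu⟩⟩
  · have hcont : Continuous fun A : Matrix (Fin N) (Fin N) ℝ => v ᵥ* A :=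
      continuous_const.matrix_vecMul continuous_id
    exact (hcont.tendsto E).comp hE
  · have h1 : ∀ dj, α dj = ∑ u : {i : Fin N // g i = Fin.natAdd L dj}, x u.1 := fun dj => by
      rw [Finset.sum_congr rfl fun u _ => hα dj u, ← Finset.mul_sum, hcsum, mul_one]
    have h2 : ∑ s : Fin (L + M), ∑ u : {i : Fin N // g i = s}, x u.1 = ∑ i, x i :=
      Fintype.sum_fiberwise g x
    rw [Fin.sum_univ_add, hxsum] at h2
    rw [Finset.sum_congr rfl fun dj _ => h1 dj, ← h2, right_eq_add]
    exact Finset.sum_eq_zero fun s _ => Finset.sum_eq_zero fun u _ =>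
      hC _ s.2 u.1 (by rw [u.2]; rfl)
end

section
/- Let P be an N×N row-stochastic matrix with the block structure of the general reducible case: the index set is partitioned into nonempty classes C₁,…,C_L, D₁,…,D_M (L ≥ 0, M ≥ 1) with (a) P_{ij} = 0 whenever the class of i comes strictly later in the order than the class of j; (b) for each j, the D_j × D_j submatrix of P is irreducible and P_{uv} = 0 for u ∈ D_j, v ∉ D_j; (c) for each i ≤ L, the C_i × C_i submatrix is irreducible or the 1×1 zero matrix and some entry P_{uv} with u ∈ C_i, v ∉ C_i is positive. Let λ ∈ (0,1), and for each j let c_j be the left Perron vector of the D_j-block, and let ĉ_j ∈ ℝ^N be c_j on D_j extended by zeros elsewhere. Then a vector v ∈ ℝ^N with all entries nonnegative and Σᵢ vᵢ = 1 satisfies (1−λ)vᵀ(I − λP)⁻¹ = vᵀ if and only if v = Σ_{j=1}^M α_j ĉ_j for some α₁,…,α_M ≥ 0 with Σ_j α_j = 1; in particular, the PageRank map PR_λ has a unique fixed point on the closed simplex if and only if M = 1. -/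
open Matrix Filter Topology

theorem aux_sum_dite {ι : Type*} [Fintype ι] (p : ι → Prop) [DecidablePred p]
    (f : {i // p i} → ℝ) :
    ∑ i, (if h : p i then f ⟨i, h⟩ else 0) = ∑ u, f u := by
  have h1 : ∀ u : {i // p i}, f u = (fun i => if h : p i then f ⟨i, h⟩ else 0) u.1 := by
    rintro ⟨u, hu⟩
    simp [hu]
  rw [Finset.sum_congr rfl (fun u _ => h1 u)]
  rw [← Finset.sum_subtype (Finset.univ.filter p) (by simp)
    (fun i => if h : p i then f ⟨i, h⟩ else 0), Finset.sum_filter]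
  refine Finset.sum_congr rfl fun i _ => ?_
  by_cases h : p i <;> simp [h]

theorem aux_sum_sub_le {ι : Type*} [Fintype ι] (p : ι → Prop) [DecidablePred p]
    (f : ι → ℝ) (hf : ∀ i, 0 ≤ f i) : ∑ u : {i // p i}, f u.1 ≤ ∑ i, f i := by
  rw [← aux_sum_dite p (fun u => f u.1)]
  refine Finset.sum_le_sum fun i _ => ?_
  by_cases h : p i <;> simp [h, hf]

theorem aux_zero_s17 {n : Type*} [Fintype n] [DecidableEq n] (Q : Matrix n n ℝ)
    (hQ : ∀ i j, 0 ≤ Q i j) (hirr : IsIrred Q) (x : n → ℝ) (hx : ∀ i, 0 ≤ x i)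
    (hxQ : ∀ j, ∑ i, x i * Q i j ≤ x j) (u : n) (hu : x u = 0) (i : n) : x i = 0 := by
  have key : ∀ k : ℕ, ∀ j, x i * (Q ^ k) i j ≤ x j := by
    intro k
    induction k with
    | zero =>
      intro j
      by_cases h : i = j
      · subst h; simp
      · simp [h, hx]
    | succ k ih =>
      intro j
      rw [pow_succ, Matrix.mul_apply, Finset.mul_sum]
      refine le_trans (Finset.sum_le_sum fun t _ => ?_) (hxQ j)
      rw [← mul_assoc]
      exact mul_le_mul_of_nonneg_right (ih t) (hQ t j)
  obtain ⟨k, -, hk⟩ := hirr i u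
  have h := key k u
  rw [hu] at h
  by_contra hne
  have : 0 < x i := lt_of_le_of_ne (hx i) (Ne.symm hne)
  have := mul_pos this hk
  linarith

theorem aux_perron {n : Type*} [Fintype n] [DecidableEq n] [Nonempty n] (Q : Matrix n n ℝ)
    (hQ : ∀ i j, 0 ≤ Q i j) (hirr : IsIrred Q) (c w : n → ℝ) (hc : ∀ i, 0 < c i)
    (hcs : ∑ i, c i = 1)
    (hcQ : ∀ j, ∑ i, c i * Q i j = c j) (hwQ : ∀ j, ∑ i, w i * Q i j = w j) (i : n) :
    w i = (∑ j, w j) * c i := by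
  obtain ⟨u, hu⟩ := Finite.exists_min (fun i => w i / c i)
  set t := w u / c u with ht
  have hz : ∀ i, w i - t * c i = 0 := by
    refine aux_zero_s17 Q hQ hirr (fun i => w i - t * c i) ?_ ?_ u ?_
    · intro i
      have := (le_div_iff₀ (hc i)).1 (hu i)
      simpa using this
    · intro j
      simp only [sub_mul, mul_assoc, Finset.sum_sub_distrib, ← Finset.mul_sum, hcQ, hwQ]
      exact le_rfl
    · have := (hc u).ne'
      simp [ht, this]
  have hw : ∀ i, w i = t * c i := fun i => by linarith [hz i]
  have : ∑ j, w j = t := by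
    rw [Finset.sum_congr rfl fun j _ => hw j, ← Finset.mul_sum, hcs, mul_one]
  rw [this, hw]

theorem aux_closed {n : Type*} [Fintype n] [DecidableEq n] (P : Matrix n n ℝ)
    (hP0 : ∀ i j, 0 ≤ P i j) (hP1 : ∀ i, ∑ j, P i j = 1) (v : n → ℝ) (hv : ∀ i, 0 ≤ v i)
    (hvP : ∀ j, ∑ i, v i * P i j = v j) (S : n → Prop) [DecidablePred S]
    (hS : ∀ i j, S i → ¬ S j → P i j = 0) (u w : n) (hu : ¬ S u) (hw : S w)
    (huw : 0 < P u w) : v u = 0 := by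
  have h1 : ∑ j, (if S j then v j else 0) =
      ∑ i, v i * ∑ j, (if S j then P i j else 0) := by
    simp only [Finset.mul_sum]
    rw [Finset.sum_comm]
    refine Finset.sum_congr rfl fun j _ => ?_
    by_cases h : S j <;> simp [h, hvP]
  have h2 : ∀ i, (if S i then v i else 0) ≤ v i * ∑ j, (if S j then P i j else 0) := by
    intro i
    by_cases h : S i
    · have : ∑ j, (if S j then P i j else 0) = 1 := by
        rw [← hP1 i]
        refine Finset.sum_congr rfl fun j _ => ?_
        by_cases h' : S j
        · simp [h']
        · simp [h', hS i j h h']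
      simp [h, this]
    · simp only [h, if_false]
      refine mul_nonneg (hv i) (Finset.sum_nonneg fun j _ => ?_)
      split_ifs
      · exact hP0 i j
      · exact le_rfl
  have h3 := (Finset.sum_eq_sum_iff_of_le (fun i _ => h2 i)).1 h1 u (Finset.mem_univ u)
  simp only [hu, if_false] at h3
  have h4 : 0 < ∑ j, (if S j then P u j else 0) := by
    refine Finset.sum_pos' (fun j _ => ?_) ⟨w, Finset.mem_univ w, by simpa [hw] using huw⟩
    split_ifs
    · exact hP0 u j
    · exact le_rfl
  rcases mul_eq_zero.1 h3.symm with h | h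
  · exact h
  · exact absurd h h4.ne'

theorem aux_fixed {n : Type*} [Fintype n] [DecidableEq n] (P : Matrix n n ℝ)
    (hP0 : ∀ i j, 0 ≤ P i j) (hP1 : ∀ i, ∑ j, P i j = 1) (lam : ℝ) (hl0 : 0 < lam)
    (hl1 : lam < 1) (v : n → ℝ) :
    (1 - lam) • (v ᵥ* (1 - lam • P)⁻¹) = v ↔ ∀ j, ∑ i, v i * P i j = v j := by
  have hdet : IsUnit (1 - lam • P).det := by
    rw [isUnit_iff_ne_zero]
    refine det_ne_zero_of_sum_row_lt_diag fun k => ?_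
    have h1 : ∑ j ∈ Finset.univ.erase k, ‖(1 - lam • P) k j‖ =
        ∑ j ∈ Finset.univ.erase k, lam * P k j := by
      refine Finset.sum_congr rfl fun j hj => ?_
      have hkj : k ≠ j := (Finset.ne_of_mem_erase hj).symm
      simp [hkj, abs_of_pos hl0, abs_of_nonneg (hP0 k j)]
    have h2 := Finset.add_sum_erase Finset.univ (fun j => P k j) (Finset.mem_univ k)
    rw [hP1] at h2
    rw [h1, ← Finset.mul_sum]
    have h3 : (1 - lam • P) k k = 1 - lam * P k k := by simp
    rw [h3, Real.norm_eq_abs]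
    refine lt_of_lt_of_le ?_ (le_abs_self _)
    nlinarith
  have hA : (1 - lam) • (v ᵥ* (1 - lam • P)⁻¹) = v ↔
      (1 - lam) • v = v ᵥ* (1 - lam • P) := by
    constructor
    · intro h
      conv_rhs => rw [← h]
      rw [Matrix.smul_vecMul, Matrix.vecMul_vecMul, Matrix.nonsing_inv_mul _ hdet,
        Matrix.vecMul_one]
    · intro h
      rw [← Matrix.smul_vecMul, h, Matrix.vecMul_vecMul, Matrix.mul_nonsing_inv _ hdet,
        Matrix.vecMul_one]
  rw [hA, Matrix.vecMul_sub, Matrix.vecMul_one, Matrix.vecMul_smul, funext_iff]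
  refine forall_congr' fun j => ?_
  have : (v ᵥ* P) j = ∑ i, v i * P i j := rfl
  simp only [Pi.smul_apply, Pi.sub_apply, smul_eq_mul, this]
  constructor
  · intro h
    have : lam * (∑ i, v i * P i j) = lam * v j := by linarith
    exact mul_left_cancel₀ hl0.ne' this
  · intro h
    rw [h]; ring

theorem stmt17 {N L M : ℕ} (hM : 1 ≤ M)
    (P : Matrix (Fin N) (Fin N) ℝ)
    (hP0 : ∀ i j, 0 ≤ P i j) (hP1 : ∀ i, ∑ j, P i j = 1)
    (g : Fin N → Fin (L + M)) (hg : Function.Surjective g)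
    (hupper : ∀ i j, g j < g i → P i j = 0)
    (hDirr : ∀ dj : Fin M, IsIrred (blockOf P g (Fin.natAdd L dj)))
    (hDdangling : ∀ (dj : Fin M) (u v : Fin N),
      g u = Fin.natAdd L dj → g v ≠ Fin.natAdd L dj → P u v = 0)
    (hCblock : ∀ ci : Fin L,
      IsIrred (blockOf P g (Fin.castAdd M ci)) ∨
        (Fintype.card {i : Fin N // g i = Fin.castAdd M ci} = 1 ∧
          ∀ u, g u = Fin.castAdd M ci → P u u = 0))
    (hCleave : ∀ ci : Fin L,
      ∃ u v : Fin N, g u = Fin.castAdd M ci ∧ g v ≠ Fin.castAdd M ci ∧ 0 < P u v)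
    (lam : ℝ) (hl0 : 0 < lam) (hl1 : lam < 1)
    (c : ∀ dj : Fin M, {i : Fin N // g i = Fin.natAdd L dj} → ℝ)
    (hcpos : ∀ dj u, 0 < c dj u) (hcsum : ∀ dj, ∑ u, c dj u = 1)
    (hcperron : ∀ dj, c dj ᵥ* blockOf P g (Fin.natAdd L dj) = c dj) :
    (∀ v : Fin N → ℝ,
      ((∀ i, 0 ≤ v i) ∧ (∑ i, v i = 1) ∧
        (1 - lam) • (v ᵥ* (1 - lam • P)⁻¹) = v) ↔
      (∃ α : Fin M → ℝ, (∀ dj, 0 ≤ α dj) ∧ (∑ dj, α dj = 1) ∧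
        v = ∑ dj, α dj •
          (fun i : Fin N =>
            if h : g i = Fin.natAdd L dj then c dj ⟨i, h⟩ else 0))) ∧
    ((∃! v : Fin N → ℝ, (∀ i, 0 ≤ v i) ∧ (∑ i, v i = 1) ∧
        (1 - lam) • (v ᵥ* (1 - lam • P)⁻¹) = v) ↔ M = 1) := by
  have hchar : ∀ v : Fin N → ℝ,
      ((∀ i, 0 ≤ v i) ∧ (∑ i, v i = 1) ∧
        (1 - lam) • (v ᵥ* (1 - lam • P)⁻¹) = v) ↔
      (∃ α : Fin M → ℝ, (∀ dj, 0 ≤ α dj) ∧ (∑ dj, α dj = 1) ∧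
        v = ∑ dj, α dj •
          (fun i : Fin N =>
            if h : g i = Fin.natAdd L dj then c dj ⟨i, h⟩ else 0)) := by
    intro v
    rw [aux_fixed P hP0 hP1 lam hl0 hl1 v]
    have hcase : ∀ s : Fin (L + M),
        (∃ ci : Fin L, s = Fin.castAdd M ci) ∨ (∃ dk : Fin M, s = Fin.natAdd L dk) := by
      intro s
      induction s using Fin.addCases with
      | left ci => exact Or.inl ⟨ci, rfl⟩
      | right dk => exact Or.inr ⟨dk, rfl⟩
    have hinj : ∀ a b : Fin M, Fin.natAdd L a = Fin.natAdd L b → a = b := by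
      intro a b h
      simpa using h
    constructor
    · rintro ⟨hv, hv1, hvP⟩
      have hC : ∀ ci : Fin L, ∀ i, g i = Fin.castAdd M ci → v i = 0 := by
        intro ci
        obtain ⟨u, w, hu, hw, huw⟩ := hCleave ci
        have hlt : Fin.castAdd M ci < g w := by
          rcases lt_trichotomy (g w) (Fin.castAdd M ci) with h | h | h
          · exact absurd (hupper u w (hu ▸ h)) huw.ne'
          · exact absurd h hw
          · exact h
        have hvu : v u = 0 := by
          refine aux_closed P hP0 hP1 v hv hvP (fun i => Fin.castAdd M ci < g i) ?_ u w ?_ hlt huw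
          · intro i j hi hj
            exact hupper i j (lt_of_le_of_lt (not_lt.1 hj) hi)
          · simp [hu]
        intro i hi
        rcases hCblock ci with hirr | ⟨hcard, -⟩
        · refine aux_zero_s17 (blockOf P g (Fin.castAdd M ci)) (fun a b => hP0 _ _) hirr
            (fun a => v a.1) (fun a => hv _) (fun j => ?_) ⟨u, hu⟩ hvu ⟨i, hi⟩
          rw [← hvP j.1]
          exact aux_sum_sub_le (fun i => g i = Fin.castAdd M ci) (fun a => v a * P a j.1)
            (fun a => mul_nonneg (hv a) (hP0 _ _))
        · have hsub := Fintype.card_le_one_iff.1 hcard.le ⟨i, hi⟩ ⟨u, hu⟩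
          have : i = u := congrArg Subtype.val hsub
          rw [this, hvu]
      have hD : ∀ dj : Fin M, ∀ i, ∀ h : g i = Fin.natAdd L dj,
          v i = (∑ u : {i : Fin N // g i = Fin.natAdd L dj}, v u.1) * c dj ⟨i, h⟩ := by
        intro dj i hi
        have : Nonempty {i : Fin N // g i = Fin.natAdd L dj} := ⟨⟨i, hi⟩⟩
        refine aux_perron (blockOf P g (Fin.natAdd L dj)) (fun a b => hP0 _ _) (hDirr dj)
          (c dj) (fun u => v u.1) (hcpos dj) (hcsum dj)
          (fun j => congrFun (hcperron dj) j) (fun j => ?_) ⟨i, hi⟩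
        refine Eq.trans ?_ (hvP j.1)
        refine (aux_sum_dite (fun i => g i = Fin.natAdd L dj)
          (fun u => v u.1 * P u.1 j.1)).symm.trans ?_
        refine Finset.sum_congr rfl fun a _ => ?_
        by_cases ha : g a = Fin.natAdd L dj
        · simp [ha]
        · simp only [ha, dif_neg, not_false_eq_true]
          rcases hcase (g a) with ⟨ci, hga⟩ | ⟨dk, hga⟩
          · rw [hC ci a hga, zero_mul]
          · have hne : g j.1 ≠ Fin.natAdd L dk := by
              rw [j.2, ← hga]; exact fun h => ha h.symm
            rw [hDdangling dk a j.1 hga hne, mul_zero]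
      have hvec : v = ∑ dj, (∑ u : {i : Fin N // g i = Fin.natAdd L dj}, v u.1) •
          (fun i : Fin N =>
            if h : g i = Fin.natAdd L dj then c dj ⟨i, h⟩ else 0) := by
        funext i
        simp only [Finset.sum_apply, Pi.smul_apply, smul_eq_mul]
        rcases hcase (g i) with ⟨ci, hgi⟩ | ⟨dk, hgi⟩
        · rw [hC ci i hgi]
          symm
          refine Finset.sum_eq_zero fun dj _ => ?_
          rw [dif_neg, mul_zero]
          intro h
          rw [hgi] at h
          have := congrArg Fin.val h
          simp at this
          omega
        · rw [Finset.sum_eq_single dk]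
          · rw [dif_pos hgi]
            exact hD dk i hgi
          · intro b _ hb
            rw [dif_neg, mul_zero]
            exact fun h => hb (hinj _ _ (hgi.symm.trans h)).symm
          · simp
      refine ⟨fun dj => ∑ u : {i : Fin N // g i = Fin.natAdd L dj}, v u.1,
        fun dj => Finset.sum_nonneg fun u _ => hv u.1, ?_, hvec⟩
      have h1 := hv1
      rw [hvec] at h1
      simp only [Finset.sum_apply, Pi.smul_apply, smul_eq_mul] at h1
      rw [Finset.sum_comm] at h1
      rw [← h1]
      refine Finset.sum_congr rfl fun dj _ => ?_
      rw [← Finset.mul_sum, aux_sum_dite (fun i => g i = Fin.natAdd L dj) (c dj), hcsum, mul_one]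
    · rintro ⟨α, hα, hα1, rfl⟩
      have he : ∀ dj j, ∑ i, (if h : g i = Fin.natAdd L dj then c dj ⟨i, h⟩ else 0) * P i j
          = if h : g j = Fin.natAdd L dj then c dj ⟨j, h⟩ else 0 := by
        intro dj j
        have h1 : ∑ i, (if h : g i = Fin.natAdd L dj then c dj ⟨i, h⟩ else 0) * P i j =
            ∑ u : {i : Fin N // g i = Fin.natAdd L dj}, c dj u * P u.1 j := by
          rw [← aux_sum_dite (fun i => g i = Fin.natAdd L dj) (fun u => c dj u * P u.1 j)]
          refine Finset.sum_congr rfl fun i _ => ?_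
          by_cases h : g i = Fin.natAdd L dj <;> simp [h]
        rw [h1]
        by_cases h : g j = Fin.natAdd L dj
        · rw [dif_pos h]
          exact congrFun (hcperron dj) ⟨j, h⟩
        · rw [dif_neg h]
          refine Finset.sum_eq_zero fun u _ => ?_
          rw [hDdangling dj u.1 j u.2 h, mul_zero]
      simp only [Finset.sum_apply, Pi.smul_apply, smul_eq_mul]
      refine ⟨?_, ?_, ?_⟩
      · intro i
        refine Finset.sum_nonneg fun dj _ => mul_nonneg (hα dj) ?_
        split_ifs
        · exact (hcpos _ _).le
        · exact le_rfl
      · rw [Finset.sum_comm, ← hα1]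
        refine Finset.sum_congr rfl fun dj _ => ?_
        rw [← Finset.mul_sum, aux_sum_dite (fun i => g i = Fin.natAdd L dj) (c dj), hcsum,
          mul_one]
      · intro j
        simp only [Finset.sum_mul]
        rw [Finset.sum_comm]
        refine Finset.sum_congr rfl fun dj _ => ?_
        simp only [mul_assoc]
        rw [← Finset.mul_sum, he]
  refine ⟨hchar, ?_⟩
  simp only [hchar]
  have hmem : ∀ dk : Fin M, ∃ α : Fin M → ℝ, (∀ dj, 0 ≤ α dj) ∧ (∑ dj, α dj = 1) ∧
      (fun i : Fin N => if h : g i = Fin.natAdd L dk then c dk ⟨i, h⟩ else 0)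
        = ∑ dj, α dj •
          (fun i : Fin N =>
            if h : g i = Fin.natAdd L dj then c dj ⟨i, h⟩ else 0) := by
    intro dk
    refine ⟨fun dj => if dj = dk then 1 else 0, ?_, ?_, ?_⟩
    · intro dj
      dsimp only
      split_ifs <;> norm_num
    · simp
    · simp
  constructor
  · intro hex
    by_contra hne
    have h := hex.unique (hmem ⟨0, by omega⟩) (hmem ⟨1, by omega⟩)
    obtain ⟨i, hi⟩ := hg (Fin.natAdd L ⟨0, by omega⟩)
    have h' := congrFun h i
    rw [dif_pos hi, dif_neg] at h'
    · exact (hcpos _ _).ne' h'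
    · rw [hi]
      intro h
      have := congrArg Fin.val h
      simp at this
  · rintro rfl
    refine ⟨_, hmem 0, ?_⟩
    rintro y ⟨α, -, hα1, rfl⟩
    have : α 0 = 1 := by simpa using hα1
    simp [this]
end

section
/- Let P be an N×N row-stochastic matrix with the block structure of the general reducible case: the index set is partitioned into nonempty classes C₁,…,C_L, D₁,…,D_M (L ≥ 0, M ≥ 1) with (a) P_{ij} = 0 whenever the class of i comes strictly later in the order than the class of j; (b) for each j, the D_j × D_j submatrix of P is irreducible and P_{uv} = 0 for u ∈ D_j, v ∉ D_j; (c) for each i ≤ L, the C_i × C_i submatrix is irreducible or the 1×1 zero matrix and some entry P_{uv} with u ∈ C_i, v ∉ C_i is positive. Let λ ∈ (0,1). Then there exists a vector v ∈ ℝ^N with all entries strictly positive, Σᵢ vᵢ = 1, and (1−λ)vᵀ(I − λP)⁻¹ = vᵀ if and only if L = 0 (i.e. every class is a dangling cluster). -/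
open Matrix Filter Topology

lemma det_ne_aux {n : Type*} [Fintype n] [DecidableEq n] (P : Matrix n n ℝ)
    (hP0 : ∀ i j, 0 ≤ P i j) (hP1 : ∀ i, ∑ j, P i j = 1)
    (lam : ℝ) (hl0 : 0 < lam) (hl1 : lam < 1) : (1 - lam • P).det ≠ 0 := by
  apply det_ne_zero_of_sum_row_lt_diag
  intro k
  have h1 : ∑ j ∈ Finset.univ.erase k, ‖(1 - lam • P) k j‖
      = ∑ j ∈ Finset.univ.erase k, lam * P k j := by
    apply Finset.sum_congr rfl
    intro j hj
    have hne : k ≠ j := fun h => (Finset.mem_erase.1 hj).1 h.symm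
    simp [Matrix.one_apply_ne hne, abs_of_nonneg (hP0 k j), abs_of_pos hl0]
  rw [h1, ← Finset.mul_sum]
  have h2 := Finset.add_sum_erase Finset.univ (fun j => P k j) (Finset.mem_univ k)
  simp only [hP1] at h2
  have h3 : (1 - lam • P) k k = 1 - lam * P k k := by simp
  rw [h3]
  refine lt_of_lt_of_le ?_ (le_abs_self _)
  nlinarith

lemma stat_aux {n : Type*} [Fintype n] [DecidableEq n] [Nonempty n] (P : Matrix n n ℝ)
    (hP0 : ∀ i j, 0 ≤ P i j) (hP1 : ∀ i, ∑ j, P i j = 1) (hirr : IsIrred P) :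
    ∃ w : n → ℝ, (∀ i, 0 < w i) ∧ w ᵥ* P = w := by
  have hdet : (P - 1).det = 0 := by
    rw [← Matrix.exists_mulVec_eq_zero_iff]
    refine ⟨fun _ => 1, ?_, ?_⟩
    · intro h
      have := congrFun h (Classical.arbitrary n)
      simp at this
    · ext i
      simp [Matrix.sub_mulVec, Matrix.mulVec, dotProduct, hP1, Matrix.one_apply]
  obtain ⟨w, hw0, hw⟩ := Matrix.exists_vecMul_eq_zero_iff.2 hdet
  rw [Matrix.vecMul_sub, Matrix.vecMul_one, sub_eq_zero] at hw
  have hle : ∀ j ∈ Finset.univ, |w j| ≤ ∑ i, |w i| * P i j := by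
    intro j _
    have : w j = ∑ i, w i * P i j := (congrFun hw j).symm
    calc |w j| = |∑ i, w i * P i j| := by rw [← this]
      _ ≤ ∑ i, |w i * P i j| := Finset.abs_sum_le_sum_abs _ _
      _ = _ := by simp [abs_mul, abs_of_nonneg (hP0 _ _)]
  have hsum : ∑ j, |w j| = ∑ j, ∑ i, |w i| * P i j := by
    rw [Finset.sum_comm]
    simp [← Finset.mul_sum, hP1]
  have heq := (Finset.sum_eq_sum_iff_of_le hle).1 hsum
  have hs : (fun i => |w i|) ᵥ* P = fun i => |w i| := by
    ext j
    exact (heq j (Finset.mem_univ j)).symm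
  refine ⟨fun i => |w i|, ?_, hs⟩
  have hpow : ∀ k : ℕ, (fun i => |w i|) ᵥ* (P ^ k) = fun i => |w i| := by
    intro k
    induction k with
    | zero => simp
    | succ k ih => rw [pow_succ, ← Matrix.vecMul_vecMul, ih, hs]
  have hpow0 : ∀ (k : ℕ) i j, 0 ≤ (P ^ k) i j := by
    intro k
    induction k with
    | zero => intro i j; rw [pow_zero, Matrix.one_apply]; split_ifs <;> norm_num
    | succ k ih =>
      intro i j
      rw [pow_succ, Matrix.mul_apply]
      exact Finset.sum_nonneg fun l _ => mul_nonneg (ih _ _) (hP0 _ _)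
  obtain ⟨i, hi⟩ := Function.ne_iff.1 hw0
  intro j
  obtain ⟨k, _, hk⟩ := hirr i j
  have h : |w j| = ∑ i, |w i| * (P ^ k) i j := (congrFun (hpow k) j).symm
  change 0 < |w j|
  rw [h]
  exact Finset.sum_pos' (fun l _ => mul_nonneg (abs_nonneg _) (hpow0 _ _ _))
    ⟨i, Finset.mem_univ _, mul_pos (abs_pos.2 hi) hk⟩

lemma sum_sub_aux {N m : ℕ} (g : Fin N → Fin m) (t : Fin m) (f : Fin N → ℝ)
    (h : ∀ i, g i ≠ t → f i = 0) :
    ∑ i : {i : Fin N // g i = t}, f i.1 = ∑ i, f i := by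
  rw [← Finset.sum_subtype (Finset.univ.filter (fun i => g i = t)) (by simp) f]
  apply Finset.sum_subset (Finset.subset_univ _)
  intro i _ hi
  exact h i fun h => hi (Finset.mem_filter.2 ⟨Finset.mem_univ _, h⟩)

theorem stmt18 {N L M : ℕ} (hM : 1 ≤ M)
    (P : Matrix (Fin N) (Fin N) ℝ)
    (hP0 : ∀ i j, 0 ≤ P i j) (hP1 : ∀ i, ∑ j, P i j = 1)
    (g : Fin N → Fin (L + M)) (hg : Function.Surjective g)
    (hupper : ∀ i j, g j < g i → P i j = 0)
    (hDirr : ∀ dj : Fin M, IsIrred (blockOf P g (Fin.natAdd L dj)))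
    (hDdangling : ∀ (dj : Fin M) (u v : Fin N),
      g u = Fin.natAdd L dj → g v ≠ Fin.natAdd L dj → P u v = 0)
    (hCblock : ∀ ci : Fin L,
      IsIrred (blockOf P g (Fin.castAdd M ci)) ∨
        (Fintype.card {i : Fin N // g i = Fin.castAdd M ci} = 1 ∧
          ∀ u, g u = Fin.castAdd M ci → P u u = 0))
    (hCleave : ∀ ci : Fin L,
      ∃ u v : Fin N, g u = Fin.castAdd M ci ∧ g v ≠ Fin.castAdd M ci ∧ 0 < P u v)
    (lam : ℝ) (hl0 : 0 < lam) (hl1 : lam < 1) :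
    (∃ v : Fin N → ℝ, (∀ i, 0 < v i) ∧ (∑ i, v i = 1) ∧
      (1 - lam) • (v ᵥ* (1 - lam • P)⁻¹) = v) ↔ L = 0 := by
  have hdet := det_ne_aux P hP0 hP1 lam hl0 hl1
  have hunit : IsUnit (1 - lam • P).det := isUnit_iff_ne_zero.2 hdet
  have hiff : ∀ v : Fin N → ℝ,
      (1 - lam) • (v ᵥ* (1 - lam • P)⁻¹) = v ↔ v ᵥ* P = v := by
    intro v
    have hexp : v ᵥ* (1 - lam • P) = v - lam • (v ᵥ* P) := by
      rw [Matrix.vecMul_sub, Matrix.vecMul_one, Matrix.vecMul_smul]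
    constructor
    · intro h
      have h2 := congrArg (fun x => x ᵥ* (1 - lam • P)) h
      simp only [Matrix.smul_vecMul, Matrix.vecMul_vecMul,
        Matrix.nonsing_inv_mul _ hunit, Matrix.vecMul_one] at h2
      rw [hexp] at h2
      ext j
      have h3 := congrFun h2 j
      simp only [Pi.smul_apply, Pi.sub_apply, smul_eq_mul] at h3
      have h4 : lam * ((v ᵥ* P) j - v j) = 0 := by linarith
      rcases mul_eq_zero.1 h4 with h5 | h5
      · exact absurd h5 hl0.ne'
      · linarith
    · intro h
      rw [← Matrix.smul_vecMul]
      have h2 : (1 - lam) • v = v ᵥ* (1 - lam • P) := by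
        rw [hexp, h, sub_smul, one_smul]
      rw [h2, Matrix.vecMul_vecMul, Matrix.mul_nonsing_inv _ hunit, Matrix.vecMul_one]
  simp only [hiff]
  constructor
  · rintro ⟨v, hv, -, hs⟩
    by_contra hL
    let c : Fin L := ⟨0, Nat.pos_of_ne_zero hL⟩
    let s : Fin (L + M) := Fin.castAdd M c
    have hs0 : ∀ t : Fin (L + M), t ≠ s → s < t := by
      intro t ht
      have : t.val ≠ 0 := fun h => ht (Fin.ext h)
      exact Nat.pos_of_ne_zero this
    obtain ⟨a, b, ha, hb, hab⟩ := hCleave c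
    let F : Finset (Fin N) := Finset.univ.filter (fun i => g i = s)
    have hcol : ∀ j ∈ F, v j = ∑ i ∈ F, v i * P i j := by
      intro j hj
      have h1 : v j = ∑ i, v i * P i j := (congrFun hs j).symm
      rw [h1]
      symm
      apply Finset.sum_subset (Finset.subset_univ _)
      intro i _ hi
      have hj' : g j = s := (Finset.mem_filter.1 hj).2
      have hi' : g i ≠ s := fun h => hi (Finset.mem_filter.2 ⟨Finset.mem_univ _, h⟩)
      rw [hupper i j (by rw [hj']; exact hs0 _ hi'), mul_zero]
    have h1 : ∑ j ∈ F, v j = ∑ i ∈ F, v i * ∑ j ∈ F, P i j := by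
      rw [Finset.sum_congr rfl hcol, Finset.sum_comm]
      simp [Finset.mul_sum]
    have hrow : ∀ i, ∑ j ∈ F, P i j ≤ 1 := by
      intro i
      rw [← hP1 i]
      exact Finset.sum_le_sum_of_subset_of_nonneg (Finset.subset_univ _)
        fun _ _ _ => hP0 _ _
    have hrowa : ∑ j ∈ F, P a j < 1 := by
      rw [← hP1 a]
      exact Finset.sum_lt_sum_of_subset (Finset.subset_univ _) (Finset.mem_univ b)
        (fun h => hb (Finset.mem_filter.1 h).2) hab fun _ _ _ => hP0 _ _
    have h2 : ∑ i ∈ F, v i * ∑ j ∈ F, P i j < ∑ i ∈ F, v i := by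
      apply Finset.sum_lt_sum
      · intro i _
        nlinarith [hv i, hrow i]
      · exact ⟨a, Finset.mem_filter.2 ⟨Finset.mem_univ _, ha⟩, by nlinarith [hv a]⟩
    linarith
  · intro hL
    have hnat : ∀ t : Fin (L + M), ∃ d : Fin M, t = Fin.natAdd L d := by
      intro t
      refine ⟨⟨t.val, by omega⟩, Fin.ext ?_⟩
      simp [hL]
    have hclosed : ∀ u v, g v ≠ g u → P u v = 0 := by
      intro u v h
      obtain ⟨d, hd⟩ := hnat (g u)
      exact hDdangling d u v hd (hd ▸ h)
    have hblk : ∀ t : Fin (L + M), ∃ w : {i : Fin N // g i = t} → ℝ,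
        (∀ i, 0 < w i) ∧ w ᵥ* (blockOf P g t) = w := by
      intro t
      obtain ⟨d, hd⟩ := hnat t
      haveI : Nonempty {i : Fin N // g i = t} := by
        obtain ⟨i, hi⟩ := hg t
        exact ⟨⟨i, hi⟩⟩
      apply stat_aux
      · intro i j
        exact hP0 _ _
      · rintro ⟨i, hi⟩
        rw [← hP1 i]
        change ∑ j : {j : Fin N // g j = t}, P i j.1 = _
        exact sum_sub_aux g t (fun j => P i j) fun j hj => hclosed i j (by rw [hi]; exact hj)
      · rw [hd]
        exact hDirr d
    choose w hw0 hw using hblk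
    let v : Fin N → ℝ := fun i => w (g i) ⟨i, rfl⟩
    have hv : ∀ (i : Fin N) (t : Fin (L + M)) (h : g i = t), v i = w t ⟨i, h⟩ := by
      intro i t h
      subst h
      rfl
    have hv0 : ∀ i, 0 < v i := fun i => hw0 _ _
    have hvP : v ᵥ* P = v := by
      ext j
      change ∑ i, v i * P i j = v j
      rw [← sum_sub_aux g (g j) (fun i => v i * P i j)
        (fun i hi => by rw [hclosed i j (Ne.symm hi), mul_zero])]
      have h1 : ∑ i : {i : Fin N // g i = g j}, w (g j) i * P i.1 j = w (g j) ⟨j, rfl⟩ :=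
        congrFun (hw (g j)) ⟨j, rfl⟩
      change _ = w (g j) ⟨j, rfl⟩
      rw [← h1]
      apply Finset.sum_congr rfl
      rintro ⟨i, hi⟩ _
      simp only
      rw [hv i (g j) hi]
    have hS : 0 < ∑ i, v i := by
      obtain ⟨i, -⟩ := hg ⟨0, by omega⟩
      exact Finset.sum_pos (fun i _ => hv0 i) ⟨i, Finset.mem_univ _⟩
    refine ⟨(∑ i, v i)⁻¹ • v, ?_, ?_, ?_⟩
    · intro i
      exact mul_pos (inv_pos.2 hS) (hv0 i)
    · simp only [Pi.smul_apply, smul_eq_mul]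
      rw [← Finset.mul_sum]
      exact inv_mul_cancel₀ hS.ne'
    · rw [Matrix.smul_vecMul, hvP]
end
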